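/- arXiv:1908.09365 — 8 statements merged into one kernel-verified Lean document; each statement's English description precedes it below -/
import Mathlib

section
/- Let K and B be self-adjoint compact operators on a Hilbert space H, with K positive and I + B positive. Suppose the eigenvalues of K (in decreasing order with multiplicity) are organized in two interlacing sequences λ_n^{(1)} = ((2n−1)a + b_1 + O(n^{-δ}))^{-B̃} and λ_n^{(2)} = (2na + b_2 + O(n^{-δ}))^{-B̃} as n → ∞, where a, B̃, δ > 0 and b_1, b_2 ∈ ℝ, and that the corresponding normalized eigenvectors h_n satisfy |(B h_n, h_m)_H| ≤ c (mn)^{-(1+δ)/2} for all m, n. Then the eigenvalues of the generalized eigenproblem K𝐡 = 𝛌(𝐡 + B𝐡), enumerated in decreasing order with multiplicity, are organized in two sequences with the same two-term asymptotics: 𝛌_n^{(1)} = ((2n−1)a + b_1 + O(n^{-δ}))^{-B̃} and 𝛌_n^{(2)} = (2na + b_2 + O(n^{-δ}))^{-B̃}. -/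
open scoped RealInnerProductSpace
open Filter

/-- The terms of the sequence `lam` are organized in two interlacing sequences
`lam^(1) n = ((2n-1) a + b₁ + O(n^(-δ)))^(-B')` and `lam^(2) n = (2n a + b₂ + O(n^(-δ)))^(-B')`
as `n → ∞`.  Here `lam` is indexed from `0`, so that `lam (2*n)` is the paper's
`lam^(1) (n+1)` (the `(2n+1)`-th term) and `lam (2*n+1)` is the paper's `lam^(2) (n+1)`
(the `(2n+2)`-th term). -/
def HasTwoSeqAsymp (lam : ℕ → ℝ) (a b₁ b₂ B' δ : ℝ) : Prop :=
  ∃ (r₁ r₂ : ℕ → ℝ) (C : ℝ) (N : ℕ),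
    (∀ n, N ≤ n → |r₁ n| ≤ C * ((n : ℝ) + 1) ^ (-δ) ∧ |r₂ n| ≤ C * ((n : ℝ) + 1) ^ (-δ)) ∧
    ∀ n, N ≤ n →
      lam (2 * n) = ((2 * (n : ℝ) + 1) * a + b₁ + r₁ n) ^ (-B') ∧
      lam (2 * n + 1) = ((2 * (n : ℝ) + 2) * a + b₂ + r₂ n) ^ (-B')

section Operator

variable {H : Type*} [NormedAddCommGroup H] [InnerProductSpace ℝ H]

/-- The quadratic form of an operator that is diagonal along a family of vectors. -/
theorem inner_apply_sum_self_of_diagonal (T : H →L[ℝ] H) (g : ℕ → H) (w : ℕ → ℝ)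
    (hT : ∀ n m, ⟪T (g n), g m⟫ = if n = m then w n else 0) (s : Finset ℕ) (x : ℕ → ℝ) :
    ⟪T (∑ j ∈ s, x j • g j), ∑ j ∈ s, x j • g j⟫ = ∑ j ∈ s, w j * x j ^ 2 := by
  simp only [map_sum, map_smul, sum_inner, inner_sum, real_inner_smul_left,
    real_inner_smul_right, hT]
  refine Finset.sum_congr rfl fun j hj => ?_
  simp only [mul_ite, mul_zero, Finset.sum_ite_eq', hj, if_true]
  ring

/-- A family that is biorthonormal for a bilinear form is linearly independent. -/
theorem linearIndependent_of_biorthonormal (A : H →L[ℝ] H) (g : ℕ → H)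
    (hg : ∀ n m, ⟪A (g n), g m⟫ = if n = m then 1 else 0) : LinearIndependent ℝ g := by
  rw [linearIndependent_iff']
  intro s x hx i hi
  have := inner_zero_left (𝕜 := ℝ) (g i)
  rw [← map_zero A, ← hx] at this
  simpa [map_sum, sum_inner, real_inner_smul_left, hg, hi] using this

/-- If a total family is biorthonormal for a bilinear form, a vector annihilated by the first `n`
members lies in the closed span of the remaining ones. -/
theorem mem_closure_span_tail (A : H →L[ℝ] H) (g : ℕ → H)
    (hg : ∀ n m, ⟪A (g n), g m⟫ = if n = m then 1 else 0)
    (hcomplete : (Submodule.span ℝ (Set.range g)).topologicalClosure = ⊤)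
    (n : ℕ) (x : H) (hx : ∀ i < n, ⟪A x, g i⟫ = 0) :
    x ∈ closure (Submodule.span ℝ (g '' Set.Ici n) : Set H) := by
  let P : H →ₗ[ℝ] H := LinearMap.id -
    ∑ i ∈ Finset.range n, (((innerSL ℝ (g i)).comp A : H →L[ℝ] ℝ) : H →ₗ[ℝ] ℝ).smulRight (g i)
  have hP : ∀ y, P y = y - ∑ i ∈ Finset.range n, ⟪A y, g i⟫ • g i := by
    intro y
    simp [P, LinearMap.sum_apply, real_inner_comm]
  have hPc : Continuous P := by
    have : (P : H → H) = fun y => y - ∑ i ∈ Finset.range n, ⟪A y, g i⟫ • g i := funext hP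
    rw [this]
    fun_prop
  have hPx : P x = x := by
    rw [hP, Finset.sum_eq_zero, sub_zero]
    intro i hi
    rw [hx i (Finset.mem_range.1 hi), zero_smul]
  have hx' : x ∈ closure (Submodule.span ℝ (Set.range g) : Set H) := by
    rw [← Submodule.topologicalClosure_coe, hcomplete]
    trivial
  rw [← hPx]
  refine map_mem_closure hPc hx' fun y hy => ?_
  have hle : Submodule.span ℝ (Set.range g) ≤
      (Submodule.span ℝ (g '' Set.Ici n)).comap P := by
    rw [Submodule.span_le]
    rintro _ ⟨j, rfl⟩
    simp only [Submodule.comap_coe, Set.mem_preimage, SetLike.mem_coe, hP, hg, ite_smul, one_smul,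
      zero_smul, Finset.sum_ite_eq, Finset.mem_range]
    split_ifs with hj
    · simp
    · rw [sub_zero]
      exact Submodule.subset_span ⟨j, not_lt.1 hj, rfl⟩
  exact hle hy

/-- Rayleigh quotient comparison: a lower bound on the span of `n + 1` independent vectors is at
most an upper bound on the closed span of the tail, from index `n` on, of a total family. -/
theorem rayleigh_le_of_span_of_tail (K A A₁ : H →L[ℝ] H) (hA : ∀ x, x ≠ 0 → 0 < ⟪A x, x⟫)
    (u v : ℕ → H) (hu : LinearIndependent ℝ u)
    (hv : ∀ n m, ⟪A₁ (v n), v m⟫ = if n = m then 1 else 0)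
    (hcomplete : (Submodule.span ℝ (Set.range v)).topologicalClosure = ⊤)
    (n : ℕ) (α β : ℝ)
    (hlow : ∀ x : ℕ → ℝ, α * ⟪A (∑ j ∈ Finset.range (n + 1), x j • u j),
        ∑ j ∈ Finset.range (n + 1), x j • u j⟫ ≤
      ⟪K (∑ j ∈ Finset.range (n + 1), x j • u j), ∑ j ∈ Finset.range (n + 1), x j • u j⟫)
    (hup : ∀ (s : Finset ℕ) (x : ℕ → ℝ), (∀ j ∈ s, n ≤ j) →
      ⟪K (∑ j ∈ s, x j • v j), ∑ j ∈ s, x j • v j⟫ ≤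
        β * ⟪A (∑ j ∈ s, x j • v j), ∑ j ∈ s, x j • v j⟫) :
    α ≤ β := by
  let S : (Fin (n + 1) → ℝ) →ₗ[ℝ] H := Fintype.linearCombination ℝ fun j => u j
  let F : (Fin (n + 1) → ℝ) →ₗ[ℝ] (Fin n → ℝ) :=
    LinearMap.pi fun i => (((innerSL ℝ (v i)).comp A₁ : H →L[ℝ] ℝ) : H →ₗ[ℝ] ℝ).comp S
  have hker : F.ker ≠ ⊥ := LinearMap.ker_ne_bot_of_finrank_lt (by simp)
  obtain ⟨x, hxF, hx0⟩ := F.ker.exists_mem_ne_zero_of_ne_bot hker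
  have hy0 : S x ≠ 0 := by
    intro h0
    refine hx0 (funext fun i => ?_)
    have hli : LinearIndependent ℝ fun j : Fin (n + 1) => u j :=
      hu.comp _ Fin.val_injective
    exact Fintype.linearIndependent_iff.1 hli x
      (by simpa [S, Fintype.linearCombination_apply] using h0) i
  have hann : ∀ i < n, ⟪A₁ (S x), v i⟫ = 0 := by
    intro i hi
    have := congrFun (LinearMap.mem_ker.1 hxF) ⟨i, hi⟩
    simpa [F, real_inner_comm] using this
  have hSx : S x = ∑ j ∈ Finset.range (n + 1),
      (if hj : j < n + 1 then x ⟨j, hj⟩ else 0) • u j := by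
    rw [Finset.sum_range]
    simp only [S, Fintype.linearCombination_apply, Fin.is_lt, dite_true]
  have h₁ : α * ⟪A (S x), S x⟫ ≤ ⟪K (S x), S x⟫ := by
    rw [hSx]
    exact hlow _
  have h₂ : ⟪K (S x), S x⟫ ≤ β * ⟪A (S x), S x⟫ := by
    have hcl : IsClosed {y : H | ⟪K y, y⟫ ≤ β * ⟪A y, y⟫} :=
      isClosed_le (by fun_prop) (by fun_prop)
    refine closure_minimal ?_ hcl (mem_closure_span_tail A₁ v hv hcomplete n _ hann)
    intro y hy
    obtain ⟨l, hl, rfl⟩ := (Finsupp.mem_span_image_iff_linearCombination ℝ).1 hy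
    rw [Finsupp.linearCombination_apply, Finsupp.sum]
    exact hup _ _ fun j hj => (Finsupp.mem_supported ℝ l).1 hl hj
  exact le_of_mul_le_mul_right (h₁.trans h₂) (hA _ hy0)

end Operator

section Scalar

/-- A chord bound for the power function on the unit interval. -/
theorem min_one_mul_one_sub_le_one_sub_rpow {t p : ℝ} (ht : 0 ≤ t) (ht1 : t ≤ 1) (hp : 0 < p) :
    min 1 p * (1 - t) ≤ 1 - t ^ p := by
  rcases le_total 1 p with h | h
  · rw [min_eq_left h]
    have := Real.rpow_le_rpow_of_exponent_ge_of_imp ht ht1 h (by intro _ h0; linarith)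
    rw [Real.rpow_one] at this
    linarith
  · rw [min_eq_right h]
    have := rpow_one_add_le_one_add_mul_self (s := t - 1) (by linarith) hp.le h
    rw [add_sub_cancel] at this
    linarith

theorem rpow_neg_div_sub_le {u v p : ℝ} (hu : 0 < u) (huv : u < v) (hp : 0 < p) :
    u ^ (-p) / (u ^ (-p) - v ^ (-p)) ≤ v / (min 1 p * (v - u)) := by
  have hv := hu.trans huv
  have hm : 0 < min 1 p := lt_min one_pos hp
  have hup : 0 < u ^ p := Real.rpow_pos_of_pos hu p
  have hvp : 0 < v ^ p := Real.rpow_pos_of_pos hv p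
  have hlt : u ^ p < v ^ p := Real.rpow_lt_rpow hu.le huv hp
  have key := min_one_mul_one_sub_le_one_sub_rpow (t := u / v) (by positivity)
    ((div_le_one hv).2 huv.le) hp
  rw [Real.div_rpow hu.le hv.le] at key
  have h1 : u ^ (-p) / (u ^ (-p) - v ^ (-p)) = 1 / (1 - u ^ p / v ^ p) := by
    rw [Real.rpow_neg hu.le, Real.rpow_neg hv.le]
    have : v ^ p - u ^ p ≠ 0 := by linarith
    field_simp
  have h2 : v / (min 1 p * (v - u)) = 1 / (min 1 p * (1 - u / v)) := by
    have : v - u ≠ 0 := by linarith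
    field_simp
  rw [h1, h2]
  refine one_div_le_one_div_of_le ?_ key
  have : u / v < 1 := (div_lt_one hv).2 huv
  have : 0 < 1 - u / v := by linarith
  positivity

/-- A sequence that grows by at least `a` over every two steps grows at least linearly. -/
theorem mul_sub_le_sub_of_two_step_gap {nu : ℕ → ℝ} {a : ℝ} {M : ℕ} (ha : 0 < a)
    (hmono : Monotone nu) (hgap : ∀ j, M ≤ j → nu j + a ≤ nu (j + 2)) {j k : ℕ} (hj : M ≤ j)
    (hjk : j + 2 ≤ k) : a / 3 * ((k : ℝ) - j) ≤ nu k - nu j := by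
  have hstep : ∀ i : ℕ, nu j + a * i ≤ nu (j + 2 * i) := by
    intro i
    induction i with
    | zero => simp
    | succ i ih =>
      have := hgap (j + 2 * i) (by omega)
      rw [show j + 2 * (i + 1) = j + 2 * i + 2 by ring]
      push_cast
      linarith
  have h1 := hstep ((k - j) / 2)
  have h2 : nu (j + 2 * ((k - j) / 2)) ≤ nu k := hmono (by omega)
  have h3 : (k : ℝ) - j ≤ 3 * (((k - j) / 2 : ℕ) : ℝ) := by
    have : k ≤ 3 * ((k - j) / 2) + j := by omega
    have : (k : ℝ) ≤ 3 * (((k - j) / 2 : ℕ) : ℝ) + j := by exact_mod_cast this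
    linarith
  nlinarith

theorem rpow_neg_mul_div_add_one_le {x d e y : ℝ} (hx : 0 < x) (hd : 0 < d) (he : 0 < e)
    (hy : 0 < y) (hyx : y ≤ x) :
    x ^ (-(1 + 2 * e)) * (x / d + 1) ≤
      y ^ (-e) * (2 * x ^ (-(1 + e)) + d ^ (-(1 + e))) := by
  have hxe : 0 < x ^ (-e) := Real.rpow_pos_of_pos hx _
  have hde : 0 < d ^ (-e) := Real.rpow_pos_of_pos hd _
  have hxy : x ^ (-e) ≤ y ^ (-e) := Real.rpow_le_rpow_of_nonpos hy hyx (by linarith)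
  have e1 : x ^ (-(1 + e)) = x ^ (-e) / x := by
    rw [show -(1 + e) = -e - 1 by ring, Real.rpow_sub_one hx.ne']
  have e2 : d ^ (-(1 + e)) = d ^ (-e) / d := by
    rw [show -(1 + e) = -e - 1 by ring, Real.rpow_sub_one hd.ne']
  have e3 : x ^ (-(1 + 2 * e)) = x ^ (-e) * (x ^ (-e) / x) := by
    rw [show -(1 + 2 * e) = -e + (-e - 1) by ring, Real.rpow_add hx, Real.rpow_sub_one hx.ne']
  have hyoung : x ^ (-e) / d ≤ x ^ (-e) / x + d ^ (-e) / d := by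
    rcases le_total x d with h | h
    · have : x ^ (-e) / d ≤ x ^ (-e) / x := by gcongr
      have : 0 ≤ d ^ (-e) / d := by positivity
      linarith
    · have h' : x ^ (-e) ≤ d ^ (-e) := Real.rpow_le_rpow_of_nonpos hd h (by linarith)
      have : x ^ (-e) / d ≤ d ^ (-e) / d := by gcongr
      have : 0 ≤ x ^ (-e) / x := by positivity
      linarith
  rw [e1, e2, e3]
  calc x ^ (-e) * (x ^ (-e) / x) * (x / d + 1)
      = x ^ (-e) * (x ^ (-e) / d + x ^ (-e) / x) := by field_simp
    _ ≤ y ^ (-e) * (2 * (x ^ (-e) / x) + d ^ (-e) / d) := by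
        refine mul_le_mul hxy ?_ (by positivity) (by positivity)
        linarith

/-- Away from the diagonal, the weighted sums of `lam n / |lam j - lam n|` become uniformly
small. -/
theorem exists_far_sum_le {lam : ℕ → ℝ} {δ L : ℝ} {M₀ : ℕ} (hδ : 0 < δ) (hL : 0 ≤ L)
    (hpos : ∀ n, 0 < lam n) (hlim : Tendsto lam atTop (nhds 0))
    (hW : ∀ n j : ℕ, M₀ ≤ n → M₀ ≤ j → (j + 2 ≤ n ∨ n + 2 ≤ j) →
      lam n / |lam j - lam n| ≤ L * (((j : ℝ) + 1) / |(j : ℝ) - n| + 1))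
    {η : ℝ} (hη : 0 < η) :
    ∃ N : ℕ, ∀ n, N ≤ n → ∀ s : Finset ℕ, (∀ j ∈ s, j + 2 ≤ n ∨ n + 2 ≤ j) →
      ∑ j ∈ s, ((j : ℝ) + 1) ^ (-(1 + δ)) * (lam n / |lam j - lam n|) ≤ η := by
  have hsum : Summable fun k : ℤ => |(k : ℝ)| ^ (-(1 + δ / 2)) :=
    Real.summable_abs_int_rpow (by linarith)
  set Z := ∑' k : ℤ, |(k : ℝ)| ^ (-(1 + δ / 2)) with hZ
  have hshift : ∀ (s : Finset ℕ) (m : ℤ),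
      ∑ j ∈ s, |(((j : ℤ) + m : ℤ) : ℝ)| ^ (-(1 + δ / 2)) ≤ Z := by
    intro s m
    have hinj : Set.InjOn (fun j : ℕ => (j : ℤ) + m) s := fun i _ j _ h => by
      simpa using h
    rw [← Finset.sum_image (f := fun k : ℤ => |(k : ℝ)| ^ (-(1 + δ / 2))) hinj]
    exact hsum.sum_le_tsum _ fun _ _ => by positivity
  have hZ0 : 0 ≤ Z := tsum_nonneg fun _ => by positivity
  have htail : Tendsto (fun M : ℕ => L * ((M : ℝ) + 1) ^ (-(δ / 2)) * (3 * Z)) atTop (nhds 0) := by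
    have h1 : Tendsto (fun M : ℕ => (M : ℝ) + 1) atTop atTop :=
      tendsto_natCast_atTop_atTop.atTop_add tendsto_const_nhds
    have := (((tendsto_rpow_neg_atTop (half_pos hδ)).comp h1).const_mul L).mul_const (3 * Z)
    simpa using this
  obtain ⟨M, hM, hMM₀⟩ :=
    ((htail.eventually_lt_const (half_pos hη)).and (eventually_ge_atTop M₀)).exists
  have hhead : Tendsto (fun n => ∑ j ∈ Finset.range M,
      ((j : ℝ) + 1) ^ (-(1 + δ)) * (lam n / |lam j - lam n|)) atTop (nhds 0) := by
    rw [show (0 : ℝ) = ∑ j ∈ Finset.range M, ((j : ℝ) + 1) ^ (-(1 + δ)) * (0 / |lam j - 0|) by simp]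
    refine tendsto_finsetSum _ fun j _ => (hlim.div ?_ ?_).const_mul _
    · exact (hlim.const_sub _).abs
    · simpa using (hpos j).ne'
  obtain ⟨N, hN⟩ := eventually_atTop.1 (hhead.eventually_lt_const (half_pos hη))
  refine ⟨max N M₀, fun n hn s hs => ?_⟩
  have hnN : N ≤ n := (le_max_left _ _).trans hn
  have hnM : M₀ ≤ n := (le_max_right _ _).trans hn
  have hterm : ∀ j : ℕ, 0 ≤ ((j : ℝ) + 1) ^ (-(1 + δ)) * (lam n / |lam j - lam n|) := fun j =>
    mul_nonneg (by positivity) (div_nonneg (hpos n).le (abs_nonneg _))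
  rw [← Finset.sum_filter_add_sum_filter_not s (fun j => j < M)]
  have h1 : ∑ j ∈ s with j < M, ((j : ℝ) + 1) ^ (-(1 + δ)) * (lam n / |lam j - lam n|) ≤ η / 2 := by
    refine le_trans ?_ (hN n hnN).le
    refine Finset.sum_le_sum_of_subset_of_nonneg ?_ fun j _ _ => hterm j
    intro j hj
    exact Finset.mem_range.2 (Finset.mem_filter.1 hj).2
  have h2 : ∑ j ∈ s with ¬ j < M, ((j : ℝ) + 1) ^ (-(1 + δ)) * (lam n / |lam j - lam n|) ≤
      η / 2 := by
    refine le_trans ?_ hM.le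
    have hj : ∀ j ∈ s.filter (fun j => ¬ j < M),
        ((j : ℝ) + 1) ^ (-(1 + δ)) * (lam n / |lam j - lam n|) ≤
        L * ((M : ℝ) + 1) ^ (-(δ / 2)) * (2 * |(((j : ℤ) + 1 : ℤ) : ℝ)| ^ (-(1 + δ / 2)) +
          |(((j : ℤ) + (-n : ℤ) : ℤ) : ℝ)| ^ (-(1 + δ / 2))) := by
      intro j hj
      obtain ⟨hjs, hjM⟩ := Finset.mem_filter.1 hj
      have hjM' : M ≤ j := not_lt.1 hjM
      have hd : 0 < |(j : ℝ) - n| := by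
        refine abs_pos.2 (sub_ne_zero.2 fun h => ?_)
        have : j = n := by exact_mod_cast h
        have := hs j hjs
        omega
      have hyoung := rpow_neg_mul_div_add_one_le (x := (j : ℝ) + 1) (d := |(j : ℝ) - n|)
        (e := δ / 2) (y := (M : ℝ) + 1) (by positivity) hd (half_pos hδ) (by positivity)
        (by have : (M : ℝ) ≤ j := by exact_mod_cast hjM'
            linarith)
      rw [show 1 + 2 * (δ / 2) = 1 + δ by ring] at hyoung
      have hWj := hW n j hnM (hMM₀.trans hjM') (hs j hjs)
      have e1 : |(((j : ℤ) + 1 : ℤ) : ℝ)| = (j : ℝ) + 1 := by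
        push_cast
        exact abs_of_pos (by positivity)
      have e2 : (((j : ℤ) + (-n : ℤ) : ℤ) : ℝ) = (j : ℝ) - n := by
        push_cast
        ring
      rw [e1, e2]
      calc ((j : ℝ) + 1) ^ (-(1 + δ)) * (lam n / |lam j - lam n|)
          ≤ ((j : ℝ) + 1) ^ (-(1 + δ)) * (L * (((j : ℝ) + 1) / |(j : ℝ) - n| + 1)) := by gcongr
        _ = L * (((j : ℝ) + 1) ^ (-(1 + δ)) * (((j : ℝ) + 1) / |(j : ℝ) - n| + 1)) := by ring
        _ ≤ L * (((M : ℝ) + 1) ^ (-(δ / 2)) * (2 * ((j : ℝ) + 1) ^ (-(1 + δ / 2)) +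
              |(j : ℝ) - n| ^ (-(1 + δ / 2)))) := by gcongr
        _ = _ := by ring
    refine (Finset.sum_le_sum hj).trans ?_
    rw [← Finset.mul_sum, Finset.sum_add_distrib, ← Finset.mul_sum]
    have := hshift (s.filter (fun j => ¬ j < M)) 1
    have := hshift (s.filter (fun j => ¬ j < M)) (-n)
    gcongr
    linarith
  linarith

/-- The weighted sums of coefficients that are controlled near the diagonal by the perturbation
scale and off the diagonal by `lam n / |lam j - lam n|`. -/
theorem exists_mul_weighted_sum_le_one {lam : ℕ → ℝ} {δ c : ℝ} (hδ : 0 < δ) (hc : 0 < c)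
    (hfar : ∀ η > 0, ∃ N : ℕ, ∀ n, N ≤ n → ∀ s : Finset ℕ, (∀ j ∈ s, j + 2 ≤ n ∨ n + 2 ≤ j) →
      ∑ j ∈ s, ((j : ℝ) + 1) ^ (-(1 + δ)) * (lam n / |lam j - lam n|) ≤ η) :
    ∃ C > 0, ∃ N : ℕ, ∀ n, N ≤ n → ∀ (s : Finset ℕ) (D : ℕ → ℝ),
      (∀ j ∈ s, D j ≤ 2 / (C * ((n : ℝ) + 1) ^ (-(1 + δ)))) →
      (∀ j ∈ s, (j + 2 ≤ n ∨ n + 2 ≤ j) → D j ≤ lam n / |lam j - lam n|) →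
      c * ∑ j ∈ s, ((j : ℝ) + 1) ^ (-(1 + δ)) * D j ≤ 1 := by
  have h2 : (0 : ℝ) < 2 ^ (1 + δ) := by positivity
  obtain ⟨N, hN⟩ := hfar (1 / (2 * c)) (by positivity)
  refine ⟨12 * 2 ^ (1 + δ) * c, by positivity, max N 1, fun n hn s D hnear hfarD => ?_⟩
  have hn1 : 1 ≤ n := (le_max_right _ _).trans hn
  set ε := ((n : ℝ) + 1) ^ (-(1 + δ)) with hε
  have hε0 : 0 < ε := by positivity
  rw [← Finset.sum_filter_add_sum_filter_not s (fun j => j + 2 ≤ n ∨ n + 2 ≤ j)]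
  have h1 : ∑ j ∈ s with (j + 2 ≤ n ∨ n + 2 ≤ j), ((j : ℝ) + 1) ^ (-(1 + δ)) * D j ≤
      1 / (2 * c) := by
    refine le_trans (Finset.sum_le_sum fun j hj => ?_)
      (hN n ((le_max_left _ _).trans hn) (s.filter fun j => j + 2 ≤ n ∨ n + 2 ≤ j)
        fun j hj => (Finset.mem_filter.1 hj).2)
    obtain ⟨hjs, hj⟩ := Finset.mem_filter.1 hj
    have := hfarD j hjs hj
    gcongr
  have h3 : ∑ j ∈ s with ¬ (j + 2 ≤ n ∨ n + 2 ≤ j), ((j : ℝ) + 1) ^ (-(1 + δ)) * D j ≤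
      3 * (1 / (6 * c)) := by
    have hcard : (s.filter fun j => ¬ (j + 2 ≤ n ∨ n + 2 ≤ j)).card ≤ 3 := by
      have hsub : (s.filter fun j => ¬ (j + 2 ≤ n ∨ n + 2 ≤ j)) ⊆ Finset.Icc (n - 1) (n + 1) := by
        intro j hj
        have := (Finset.mem_filter.1 hj).2
        rw [Finset.mem_Icc]
        omega
      refine (Finset.card_le_card hsub).trans ?_
      rw [Nat.card_Icc]
      omega
    have hterm : ∀ j ∈ s.filter fun j => ¬ (j + 2 ≤ n ∨ n + 2 ≤ j),
        ((j : ℝ) + 1) ^ (-(1 + δ)) * D j ≤ 1 / (6 * c) := by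
      intro j hj
      obtain ⟨hjs, hj⟩ := Finset.mem_filter.1 hj
      have hnj : n ≤ j + 1 := by omega
      have hnj' : (n : ℝ) ≤ j + 1 := by exact_mod_cast hnj
      have hn1' : (1 : ℝ) ≤ n := by exact_mod_cast hn1
      have hw : ((j : ℝ) + 1) ^ (-(1 + δ)) ≤ 2 ^ (1 + δ) * ε := by
        have : ((j : ℝ) + 1) ^ (-(1 + δ)) ≤ (((n : ℝ) + 1) / 2) ^ (-(1 + δ)) :=
          Real.rpow_le_rpow_of_nonpos (by positivity) (by linarith) (by linarith)
        refine this.trans (le_of_eq ?_)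
        rw [Real.div_rpow (by positivity) (by norm_num), Real.rpow_neg (by norm_num : (0 : ℝ) ≤ 2)]
        field_simp
        exact hε.symm
      have hD := hnear j hjs
      calc ((j : ℝ) + 1) ^ (-(1 + δ)) * D j
          ≤ ((j : ℝ) + 1) ^ (-(1 + δ)) * (2 / (12 * 2 ^ (1 + δ) * c * ε)) := by gcongr
        _ ≤ (2 ^ (1 + δ) * ε) * (2 / (12 * 2 ^ (1 + δ) * c * ε)) := by gcongr
        _ = 1 / (6 * c) := by
            field_simp
            norm_num
    refine (Finset.sum_le_card_nsmul _ _ _ hterm).trans ?_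
    rw [nsmul_eq_mul]
    gcongr
    exact_mod_cast hcard
  calc c * (_ + _) ≤ c * (1 / (2 * c) + 3 * (1 / (6 * c))) := by gcongr
    _ = 1 := by
      field_simp
      norm_num

end Scalar

section Perturbation

variable {H : Type*} [NormedAddCommGroup H] [InnerProductSpace ℝ H]

/-- A form whose matrix is bounded by a rank-one matrix is dominated by a diagonal form. -/
theorem mul_abs_inner_apply_sum_self_le (B : H →L[ℝ] H) (h : ℕ → H) {δ c κ : ℝ} (hc : 0 ≤ c)
    (hκ : 0 ≤ κ)
    (hBh : ∀ n m : ℕ,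
      |⟪B (h n), h m⟫| ≤ c * (((n : ℝ) + 1) * ((m : ℝ) + 1)) ^ (-(1 + δ) / 2))
    (s : Finset ℕ) (x d : ℕ → ℝ) (hd : ∀ j ∈ s, 0 < d j)
    (hsum : c * ∑ j ∈ s, ((j : ℝ) + 1) ^ (-(1 + δ)) * (κ / d j) ≤ 1) :
    κ * |⟪B (∑ j ∈ s, x j • h j), ∑ j ∈ s, x j • h j⟫| ≤ ∑ j ∈ s, d j * x j ^ 2 := by
  set w : ℕ → ℝ := fun j => ((j : ℝ) + 1) ^ (-(1 + δ) / 2) with hw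
  have hw2 : ∀ j, w j ^ 2 = ((j : ℝ) + 1) ^ (-(1 + δ)) := by
    intro j
    rw [hw, ← Real.rpow_natCast, ← Real.rpow_mul (by positivity)]
    congr 1
    push_cast
    ring
  have hform : |⟪B (∑ j ∈ s, x j • h j), ∑ j ∈ s, x j • h j⟫| ≤ c * (∑ j ∈ s, |x j| * w j) ^ 2 := by
    simp only [map_sum, map_smul, sum_inner, inner_sum, real_inner_smul_left,
      real_inner_smul_right]
    rw [sq, Finset.sum_mul_sum, Finset.mul_sum]
    refine (Finset.abs_sum_le_sum_abs _ _).trans (Finset.sum_le_sum fun i _ => ?_)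
    rw [Finset.mul_sum]
    refine (Finset.abs_sum_le_sum_abs _ _).trans (Finset.sum_le_sum fun j _ => ?_)
    rw [abs_mul, abs_mul]
    have hij := hBh j i
    rw [Real.mul_rpow (by positivity) (by positivity)] at hij
    calc _ = |x i| * (|x j| * |⟪B (h j), h i⟫|) := by ring
      _ ≤ |x i| * (|x j| * (c * (w j * w i))) := by gcongr
      _ = _ := by ring
  have hcs : κ * (∑ j ∈ s, |x j| * w j) ^ 2 ≤
      (∑ j ∈ s, ((j : ℝ) + 1) ^ (-(1 + δ)) * (κ / d j)) * ∑ j ∈ s, d j * x j ^ 2 := by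
    have := Finset.sum_sq_le_sum_mul_sum_of_sq_le_mul s (r := fun j => |x j| * w j)
      (f := fun j => ((j : ℝ) + 1) ^ (-(1 + δ)) / d j) (g := fun j => d j * x j ^ 2)
      (fun j hj => div_nonneg (by positivity) (hd j hj).le)
      (fun j hj => mul_nonneg (hd j hj).le (sq_nonneg _))
      (fun j hj => by
        have := (hd j hj).ne'
        rw [mul_pow, sq_abs, hw2]
        field_simp
        exact le_rfl)
    calc _ ≤ κ * _ := mul_le_mul_of_nonneg_left this hκ
      _ = _ := by
        rw [← mul_assoc]
        congr 1
        rw [Finset.mul_sum]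
        exact Finset.sum_congr rfl fun j _ => by ring
  have hQ : 0 ≤ ∑ j ∈ s, d j * x j ^ 2 :=
    Finset.sum_nonneg fun j hj => mul_nonneg (hd j hj).le (sq_nonneg _)
  calc κ * |⟪B (∑ j ∈ s, x j • h j), ∑ j ∈ s, x j • h j⟫|
      ≤ κ * (c * (∑ j ∈ s, |x j| * w j) ^ 2) := mul_le_mul_of_nonneg_left hform hκ
    _ = c * (κ * (∑ j ∈ s, |x j| * w j) ^ 2) := by ring
    _ ≤ c * ((∑ j ∈ s, ((j : ℝ) + 1) ^ (-(1 + δ)) * (κ / d j)) * ∑ j ∈ s, d j * x j ^ 2) := by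
        gcongr
    _ = (c * ∑ j ∈ s, ((j : ℝ) + 1) ^ (-(1 + δ)) * (κ / d j)) * ∑ j ∈ s, d j * x j ^ 2 := by
        ring
    _ ≤ 1 * ∑ j ∈ s, d j * x j ^ 2 := by gcongr
    _ = _ := one_mul _

/-- The generalized eigenvalues are relatively close to the unperturbed ones, at the scale
`n ^ (-(1 + δ))`, provided the off-diagonal weights are summable to a small total. -/
theorem exists_abs_generalized_eigenvalue_sub_le (K B : H →L[ℝ] H)
    (hpd : ∀ x : H, x ≠ 0 → 0 < ⟪x + B x, x⟫) {δ c : ℝ} (hδ : 0 < δ) (hc : 0 < c)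
    {lam mu : ℕ → ℝ} {h g : ℕ → H} (hlpos : ∀ n, 0 < lam n) (hlanti : Antitone lam)
    (heig : ∀ n, K (h n) = lam n • h n) (hon : Orthonormal ℝ h)
    (hcomplete : (Submodule.span ℝ (Set.range h)).topologicalClosure = ⊤)
    (hBh : ∀ n m : ℕ,
      |⟪B (h n), h m⟫| ≤ c * (((n : ℝ) + 1) * ((m : ℝ) + 1)) ^ (-(1 + δ) / 2))
    (hmanti : Antitone mu) (hgeig : ∀ n, K (g n) = mu n • (g n + B (g n)))
    (hgon : ∀ n m, ⟪g n + B (g n), g m⟫ = if n = m then 1 else 0)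
    (hgcomplete : (Submodule.span ℝ (Set.range g)).topologicalClosure = ⊤)
    (hsep : ∃ N : ℕ, ∀ n, N ≤ n → ∀ j, (j + 2 ≤ n ∨ n + 2 ≤ j) → lam j ≠ lam n)
    (hfar : ∀ η > 0, ∃ N : ℕ, ∀ n, N ≤ n → ∀ s : Finset ℕ, (∀ j ∈ s, j + 2 ≤ n ∨ n + 2 ≤ j) →
      ∑ j ∈ s, ((j : ℝ) + 1) ^ (-(1 + δ)) * (lam n / |lam j - lam n|) ≤ η) :
    ∃ C : ℝ, ∃ N : ℕ, ∀ n, N ≤ n →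
      |mu n - lam n| ≤ lam n * (C * ((n : ℝ) + 1) ^ (-(1 + δ))) := by
  obtain ⟨C, hC, N₁, hN₁⟩ := exists_mul_weighted_sum_le_one hδ hc hfar
  obtain ⟨N₂, hN₂⟩ := hsep
  have hεlim : Tendsto (fun n : ℕ => C * ((n : ℝ) + 1) ^ (-(1 + δ))) atTop (nhds 0) := by
    have h1 : Tendsto (fun n : ℕ => (n : ℝ) + 1) atTop atTop :=
      tendsto_natCast_atTop_atTop.atTop_add tendsto_const_nhds
    simpa using ((tendsto_rpow_neg_atTop (by linarith : 0 < 1 + δ)).comp h1).const_mul C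
  obtain ⟨N₃, hN₃⟩ := eventually_atTop.1 (hεlim.eventually_lt_const one_pos)
  have hh : ∀ n m, ⟪(ContinuousLinearMap.id ℝ H) (h n), h m⟫ = if n = m then 1 else 0 :=
    orthonormal_iff_ite.1 hon
  have hg : ∀ n m, ⟪(ContinuousLinearMap.id ℝ H + B) (g n), g m⟫ = if n = m then 1 else 0 := hgon
  have hKh : ∀ n m, ⟪K (h n), h m⟫ = if n = m then lam n else 0 := fun n m => by
    rw [heig, real_inner_smul_left, orthonormal_iff_ite.1 hon, mul_ite, mul_one, mul_zero]
  have hKg : ∀ n m, ⟪K (g n), g m⟫ = if n = m then mu n else 0 := fun n m => by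
    rw [hgeig, real_inner_smul_left, hgon, mul_ite, mul_one, mul_zero]
  have hsplit : ∀ x : H, ⟪(ContinuousLinearMap.id ℝ H + B) x, x⟫ =
      ⟪(ContinuousLinearMap.id ℝ H) x, x⟫ + ⟪B x, x⟫ := fun x => inner_add_left _ _ _
  refine ⟨C, max N₁ (max N₂ N₃), fun n hn => ?_⟩
  simp only [max_le_iff] at hn
  obtain ⟨hn₁, hn₂, hn₃⟩ := hn
  set ε := C * ((n : ℝ) + 1) ^ (-(1 + δ)) with hε
  have hε0 : 0 < ε := by positivity
  have hε1 : ε < 1 := hN₃ n hn₃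
  have hl := hlpos n
  have hle0 : 0 < lam n * ε := by positivity
  have hlow : lam n - lam n * ε ≤ mu n := by
    set θ := lam n - lam n * ε with hθ
    have hθ0 : 0 ≤ θ := by nlinarith
    refine rayleigh_le_of_span_of_tail K (ContinuousLinearMap.id ℝ H + B) _ hpd h g
      hon.linearIndependent hg hgcomplete n _ _ (fun x => ?_) fun s x hs => ?_
    · have hd : ∀ j ∈ Finset.range (n + 1), lam n * ε ≤ lam j - θ := fun j hj => by
        have := hlanti (Nat.lt_succ_iff.1 (Finset.mem_range.1 hj))
        rw [hθ]
        linarith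
      have hsum := hN₁ n hn₁ (Finset.range (n + 1)) (fun j => θ / (lam j - θ))
        (fun j hj => by
          calc θ / (lam j - θ) ≤ lam n / (lam n * ε) :=
                div_le_div₀ hl.le (by linarith) hle0 (hd j hj)
            _ = 1 / ε := by field_simp
            _ ≤ 2 / ε := by gcongr; norm_num)
        (fun j hj hjn => by
          have hjle := hlanti (Nat.lt_succ_iff.1 (Finset.mem_range.1 hj))
          have hlt : lam n < lam j := lt_of_le_of_ne hjle (hN₂ n hn₂ j hjn).symm
          rw [abs_of_pos (sub_pos.2 hlt)]
          exact div_le_div₀ hl.le (by linarith) (by linarith) (by linarith))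
      have hB := mul_abs_inner_apply_sum_self_le B h hc.le hθ0 hBh _ x (fun j => lam j - θ)
        (fun j hj => hle0.trans_le (hd j hj)) hsum
      rw [hsplit, inner_apply_sum_self_of_diagonal _ h _ hh,
        inner_apply_sum_self_of_diagonal _ h _ hKh]
      simp only [one_mul, sub_mul, Finset.sum_sub_distrib, ← Finset.mul_sum] at hB ⊢
      have := mul_le_mul_of_nonneg_left (le_abs_self ⟪B (∑ j ∈ Finset.range (n + 1), x j • h j),
        ∑ j ∈ Finset.range (n + 1), x j • h j⟫) hθ0
      linarith
    · rw [inner_apply_sum_self_of_diagonal _ g _ hg, inner_apply_sum_self_of_diagonal _ g _ hKg,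
        Finset.mul_sum]
      refine Finset.sum_le_sum fun j hj => ?_
      rw [one_mul]
      exact mul_le_mul_of_nonneg_right (hmanti (hs j hj)) (sq_nonneg _)
  have hup : mu n ≤ lam n + lam n * ε := by
    set θ := lam n + lam n * ε with hθ
    have hθ0 : 0 ≤ θ := by positivity
    refine rayleigh_le_of_span_of_tail K (ContinuousLinearMap.id ℝ H + B) _ hpd g h
      (linearIndependent_of_biorthonormal _ g hg) hh hcomplete n _ _ (fun x => ?_) fun s x hs => ?_
    · rw [inner_apply_sum_self_of_diagonal _ g _ hg, inner_apply_sum_self_of_diagonal _ g _ hKg,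
        Finset.mul_sum]
      refine Finset.sum_le_sum fun j hj => ?_
      rw [one_mul]
      exact mul_le_mul_of_nonneg_right (hmanti (Nat.lt_succ_iff.1 (Finset.mem_range.1 hj)))
        (sq_nonneg _)
    · have hd : ∀ j ∈ s, lam n * ε ≤ θ - lam j := fun j hj => by
        have := hlanti (hs j hj)
        rw [hθ]
        linarith
      have hsum := hN₁ n hn₁ s (fun j => θ / (θ - lam j))
        (fun j hj => by
          calc θ / (θ - lam j) ≤ (2 * lam n) / (lam n * ε) :=
                div_le_div₀ (by positivity) (by nlinarith) hle0 (hd j hj)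
            _ = 2 / ε := by field_simp)
        (fun j hj hjn => by
          have hlt : lam j < lam n := lt_of_le_of_ne (hlanti (hs j hj)) (hN₂ n hn₂ j hjn)
          rw [abs_sub_comm, abs_of_pos (sub_pos.2 hlt),
            div_le_div_iff₀ (by linarith) (by linarith)]
          nlinarith [mul_pos hle0 (hlpos j)])
      have hB := mul_abs_inner_apply_sum_self_le B h hc.le hθ0 hBh _ x (fun j => θ - lam j)
        (fun j hj => hle0.trans_le (hd j hj)) hsum
      rw [hsplit, inner_apply_sum_self_of_diagonal _ h _ hh,
        inner_apply_sum_self_of_diagonal _ h _ hKh]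
      simp only [one_mul, sub_mul, Finset.sum_sub_distrib, ← Finset.mul_sum] at hB ⊢
      have := mul_le_mul_of_nonneg_left (neg_abs_le ⟪B (∑ j ∈ s, x j • h j),
        ∑ j ∈ s, x j • h j⟫) hθ0
      linarith
  rw [abs_le]
  constructor <;> linarith

end Perturbation

section Asymptotics

/-- The two-sequence asymptotics in terms of the powers `lam n ^ (-B'⁻¹)`. -/
theorem HasTwoSeqAsymp.exists_abs_rpow_sub_le {lam : ℕ → ℝ} {a b₁ b₂ B' δ : ℝ}
    (hl : HasTwoSeqAsymp lam a b₁ b₂ B' δ) (ha : 0 < a) (hB' : 0 < B') (hδ : 0 < δ) :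
    ∃ (C : ℝ) (N : ℕ), ∀ n, N ≤ n →
      |lam (2 * n) ^ (-B'⁻¹) - ((2 * (n : ℝ) + 1) * a + b₁)| ≤ C * ((n : ℝ) + 1) ^ (-δ) ∧
      |lam (2 * n + 1) ^ (-B'⁻¹) - ((2 * (n : ℝ) + 2) * a + b₂)| ≤ C * ((n : ℝ) + 1) ^ (-δ) := by
  obtain ⟨r₁, r₂, C, N, hr, hlam⟩ := hl
  have hnat : Tendsto (fun n : ℕ => (n : ℝ)) atTop atTop := tendsto_natCast_atTop_atTop
  have hsmall : Tendsto (fun n : ℕ => C * ((n : ℝ) + 1) ^ (-δ)) atTop (nhds 0) := by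
    simpa using ((tendsto_rpow_neg_atTop hδ).comp
      (hnat.atTop_add (tendsto_const_nhds (x := (1 : ℝ))))).const_mul C
  have hlarge : Tendsto (fun n : ℕ => (n : ℝ) * a) atTop atTop := hnat.atTop_mul_const ha
  obtain ⟨N', hN'⟩ := eventually_atTop.1 ((hsmall.eventually_lt_const one_pos).and
    (hlarge.eventually_gt_atTop (|b₁| + |b₂| + 1)))
  refine ⟨C, max N N', fun n hn => ?_⟩
  obtain ⟨hr₁, hr₂⟩ := hr n ((le_max_left _ _).trans hn)
  obtain ⟨hl₁, hl₂⟩ := hlam n ((le_max_left _ _).trans hn)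
  obtain ⟨hs, hL⟩ := hN' n ((le_max_right _ _).trans hn)
  have hna : 0 ≤ (n : ℝ) * a := by positivity
  have hinv : ∀ X : ℝ, 0 < X → (X ^ (-B')) ^ (-B'⁻¹) = X := fun X hX => by
    rw [← Real.rpow_mul hX.le, neg_mul_neg, mul_inv_cancel₀ hB'.ne', Real.rpow_one]
  have h1 := abs_le.1 hr₁
  have h2 := abs_le.1 hr₂
  have h3 := neg_abs_le b₁
  have h4 := neg_abs_le b₂
  have h5 := abs_nonneg b₁
  have h6 := abs_nonneg b₂
  rw [hl₁, hl₂, hinv _ (by linarith), hinv _ (by linarith), add_sub_cancel_left,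
    add_sub_cancel_left]
  exact ⟨hr₁, hr₂⟩

theorem HasTwoSeqAsymp.of_abs_rpow_sub_le {lam : ℕ → ℝ} {a b₁ b₂ B' δ : ℝ} (hB' : 0 < B')
    (hpos : ∀ n, 0 < lam n) {C : ℝ} {N : ℕ}
    (hC : ∀ n, N ≤ n →
      |lam (2 * n) ^ (-B'⁻¹) - ((2 * (n : ℝ) + 1) * a + b₁)| ≤ C * ((n : ℝ) + 1) ^ (-δ) ∧
      |lam (2 * n + 1) ^ (-B'⁻¹) - ((2 * (n : ℝ) + 2) * a + b₂)| ≤ C * ((n : ℝ) + 1) ^ (-δ)) :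
    HasTwoSeqAsymp lam a b₁ b₂ B' δ := by
  refine ⟨_, _, C, N, hC, fun n _ => ?_⟩
  have hinv : ∀ X : ℝ, 0 < X → X = (X ^ (-B'⁻¹)) ^ (-B') := fun X hX => by
    rw [← Real.rpow_mul hX.le, neg_mul_neg, inv_mul_cancel₀ hB'.ne', Real.rpow_one]
  constructor
  · rw [add_sub_cancel]
    exact hinv _ (hpos _)
  · rw [add_sub_cancel]
    exact hinv _ (hpos _)

/-- Eventual linear growth and two-step gaps from the two-sequence asymptotics. -/
theorem exists_linear_growth_and_gap {nu : ℕ → ℝ} {a b₁ b₂ δ C : ℝ} {N : ℕ} (ha : 0 < a)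
    (hδ : 0 < δ)
    (hnu : ∀ n, N ≤ n →
      |nu (2 * n) - ((2 * (n : ℝ) + 1) * a + b₁)| ≤ C * ((n : ℝ) + 1) ^ (-δ) ∧
      |nu (2 * n + 1) - ((2 * (n : ℝ) + 2) * a + b₂)| ≤ C * ((n : ℝ) + 1) ^ (-δ)) :
    ∃ (M : ℕ) (L : ℝ), 0 < L ∧ ∀ j, M ≤ j →
      nu j + a ≤ nu (j + 2) ∧ a * j - L ≤ nu j ∧ nu j ≤ L * ((j : ℝ) + 1) := by
  have hnat : Tendsto (fun n : ℕ => (n : ℝ)) atTop atTop := tendsto_natCast_atTop_atTop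
  have hsmall : Tendsto (fun n : ℕ => C * ((n : ℝ) + 1) ^ (-δ)) atTop (nhds 0) := by
    simpa using ((tendsto_rpow_neg_atTop hδ).comp
      (hnat.atTop_add (tendsto_const_nhds (x := (1 : ℝ))))).const_mul C
  obtain ⟨N', hN'⟩ := eventually_atTop.1 (hsmall.eventually_lt_const (half_pos ha))
  refine ⟨2 * max N N', 3 * a + |b₁| + |b₂|, by positivity, fun j hj => ?_⟩
  have h3 := neg_abs_le b₁
  have h4 := neg_abs_le b₂
  have h5 := le_abs_self b₁
  have h6 := le_abs_self b₂
  have h7 := abs_nonneg b₁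
  have h8 := abs_nonneg b₂
  obtain ⟨m, hjm⟩ : ∃ m, j = 2 * m ∨ j = 2 * m + 1 := ⟨j / 2, by omega⟩
  have hm0 : (0 : ℝ) ≤ m := Nat.cast_nonneg _
  have h9 : 0 ≤ m * |b₁| := mul_nonneg hm0 h7
  have h10 : 0 ≤ m * |b₂| := mul_nonneg hm0 h8
  have h11 : 0 ≤ m * a := mul_nonneg hm0 ha.le
  have hm : max N N' ≤ m := by omega
  have hmN : N ≤ m := (le_max_left _ _).trans hm
  have hmN' : N' ≤ m := (le_max_right _ _).trans hm
  obtain ⟨he, ho⟩ := hnu _ hmN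
  obtain ⟨he', ho'⟩ := hnu _ (hmN.trans (Nat.le_succ _))
  have hs := hN' _ hmN'
  have hs' := hN' _ (hmN'.trans (Nat.le_succ _))
  rw [abs_le] at he ho he' ho'
  rcases hjm with rfl | rfl
  · rw [show 2 * (m + 1) = 2 * m + 2 by ring] at he'
    push_cast at *
    refine ⟨by linarith, by linarith, ?_⟩
    nlinarith
  · rw [show 2 * (m + 1) + 1 = 2 * m + 1 + 2 by ring] at ho'
    push_cast at *
    refine ⟨by linarith, by linarith, ?_⟩
    nlinarith

/-- Off the diagonal, `lam n / |lam j - lam n|` is controlled by the index distance. -/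
theorem rpow_neg_div_abs_sub_le {nu : ℕ → ℝ} {a p L : ℝ} {M : ℕ} (ha : 0 < a) (hp : 0 < p)
    (hpos : ∀ n, 0 < nu n) (hmono : Monotone nu)
    (hnu : ∀ j, M ≤ j → nu j + a ≤ nu (j + 2)) (hL : ∀ j, M ≤ j → nu j ≤ L * ((j : ℝ) + 1))
    {n j : ℕ} (hn : M ≤ n) (hj : M ≤ j) (hnj : j + 2 ≤ n ∨ n + 2 ≤ j) :
    nu n ^ (-p) / |nu j ^ (-p) - nu n ^ (-p)| ≤
      3 * L / (min 1 p * a) * (((j : ℝ) + 1) / |(j : ℝ) - n| + 1) := by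
  have hm : 0 < min 1 p := lt_min one_pos hp
  have hL0 : 0 < L :=
    pos_of_mul_pos_left ((hpos n).trans_le (hL n hn)) (by positivity)
  have key : ∀ i k : ℕ, M ≤ i → M ≤ k → i + 2 ≤ k →
      nu k ^ (-p) < nu i ^ (-p) ∧ nu i ^ (-p) / (nu i ^ (-p) - nu k ^ (-p)) ≤
        3 * L / (min 1 p * a) * (((k : ℝ) + 1) / ((k : ℝ) - i)) := by
    intro i k hi hk hik
    have hgap := mul_sub_le_sub_of_two_step_gap ha hmono hnu hi hik
    have hki : (0 : ℝ) < (k : ℝ) - i := by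
      have : i < k := by omega
      exact sub_pos.2 (by exact_mod_cast this)
    have hak : 0 < a / 3 * ((k : ℝ) - i) := by positivity
    have hlt : nu i < nu k := by linarith
    refine ⟨Real.rpow_lt_rpow_of_neg (hpos i) hlt (by linarith), ?_⟩
    calc _ ≤ nu k / (min 1 p * (nu k - nu i)) := rpow_neg_div_sub_le (hpos i) hlt hp
      _ ≤ L * ((k : ℝ) + 1) / (min 1 p * (a / 3 * ((k : ℝ) - i))) := by
          have := hL k hk
          gcongr
      _ = _ := by field_simp
  have hK : 0 ≤ 3 * L / (min 1 p * a) := by positivity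
  rcases hnj with h | h
  · obtain ⟨hlt, hle⟩ := key j n hj hn h
    have hd : (0 : ℝ) < (n : ℝ) - j := by
      have : j < n := by omega
      exact sub_pos.2 (by exact_mod_cast this)
    rw [abs_of_pos (sub_pos.2 hlt), abs_sub_comm, abs_of_pos hd]
    calc _ ≤ nu j ^ (-p) / (nu j ^ (-p) - nu n ^ (-p)) :=
          div_le_div_of_nonneg_right hlt.le (sub_pos.2 hlt).le
      _ ≤ _ := hle
      _ = _ := by
          rw [div_add_one hd.ne']
          congr 2
          ring
  · obtain ⟨hlt, hle⟩ := key n j hn hj h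
    have hd : (0 : ℝ) < (j : ℝ) - n := by
      have : n < j := by omega
      exact sub_pos.2 (by exact_mod_cast this)
    rw [abs_sub_comm, abs_of_pos (sub_pos.2 hlt), abs_of_pos hd]
    exact hle.trans (mul_le_mul_of_nonneg_left (by linarith) hK)

/-- Relative closeness at scale `n ^ (-(1 + δ))` gives closeness at scale `n ^ (-δ)` of negative
powers with at most linear growth. -/
theorem exists_abs_rpow_sub_rpow_le {lam mu : ℕ → ℝ} {δ C L q : ℝ} {N : ℕ} (hδ : 0 < δ)
    (hlpos : ∀ n, 0 < lam n) (hmpos : ∀ n, 0 < mu n)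
    (hmu : ∀ n, N ≤ n → |mu n - lam n| ≤ lam n * (C * ((n : ℝ) + 1) ^ (-(1 + δ))))
    (hL : ∀ n, N ≤ n → lam n ^ q ≤ L * ((n : ℝ) + 1)) :
    ∃ C' ≥ 0, ∃ N' : ℕ, ∀ n, N' ≤ n → |mu n ^ q - lam n ^ q| ≤ C' * ((n : ℝ) + 1) ^ (-δ) := by
  have hratio : ∀ n, N ≤ n → |mu n / lam n - 1| ≤ C * ((n : ℝ) + 1) ^ (-(1 + δ)) := by
    intro n hn
    rw [div_sub_one (hlpos n).ne', abs_div, abs_of_pos (hlpos n), div_le_iff₀ (hlpos n), mul_comm]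
    exact hmu n hn
  have hlim : Tendsto (fun n => mu n / lam n) atTop (nhds 1) := by
    rw [tendsto_iff_norm_sub_tendsto_zero]
    have h1 : Tendsto (fun n : ℕ => (n : ℝ) + 1) atTop atTop :=
      tendsto_natCast_atTop_atTop.atTop_add tendsto_const_nhds
    have hε : Tendsto (fun n : ℕ => C * ((n : ℝ) + 1) ^ (-(1 + δ))) atTop (nhds 0) := by
      simpa using ((tendsto_rpow_neg_atTop (by linarith : 0 < 1 + δ)).comp h1).const_mul C
    refine squeeze_zero' (Eventually.of_forall fun _ => norm_nonneg _) ?_ hε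
    filter_upwards [eventually_ge_atTop N] with n hn using hratio n hn
  have hder := (Real.hasDerivAt_rpow_const (x := 1) (p := q) (Or.inl one_ne_zero)).isBigO_sub
  obtain ⟨D, hD, hbound⟩ := (hder.comp_tendsto hlim).exists_nonneg
  obtain ⟨N₁, hN₁⟩ := eventually_atTop.1 hbound.bound
  have hL0 : 0 < L := pos_of_mul_pos_left
    ((Real.rpow_pos_of_pos (hlpos N) q).trans_le (hL N le_rfl)) (by positivity)
  have hC0 : 0 ≤ C := nonneg_of_mul_nonneg_left ((abs_nonneg _).trans (hratio N le_rfl))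
    (by positivity)
  refine ⟨L * (D * C), by positivity, max N N₁, fun n hn => ?_⟩
  have hnN : N ≤ n := (le_max_left _ _).trans hn
  have hb := hN₁ n ((le_max_right _ _).trans hn)
  simp only [Function.comp_apply, Real.one_rpow, Real.norm_eq_abs] at hb
  rw [Real.div_rpow (hmpos n).le (hlpos n).le] at hb
  have hlq : 0 < lam n ^ q := Real.rpow_pos_of_pos (hlpos n) q
  have hn1 : (0 : ℝ) < (n : ℝ) + 1 := by positivity
  calc |mu n ^ q - lam n ^ q| = lam n ^ q * |mu n ^ q / lam n ^ q - 1| := by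
        rw [div_sub_one hlq.ne', abs_div, abs_of_pos hlq, mul_div_cancel₀ _ hlq.ne']
    _ ≤ (L * ((n : ℝ) + 1)) * (D * (C * ((n : ℝ) + 1) ^ (-(1 + δ)))) := by
        have := hL n hnN
        have := hb.trans (mul_le_mul_of_nonneg_left (hratio n hnN) hD)
        gcongr
    _ = L * (D * C) * (((n : ℝ) + 1) ^ (1 : ℝ) * ((n : ℝ) + 1) ^ (-(1 + δ))) := by
        rw [Real.rpow_one]
        ring
    _ = _ := by
        rw [← Real.rpow_add hn1]
        congr 2
        ring

end Asymptotics

/-- **Remark (for Lemma 1).** If the eigenvalues of `K` (in decreasing order with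
multiplicity) are organized in two interlacing sequences
`lam^(1) n = ((2n-1) a + b₁ + O(n^(-δ)))^(-B')`, `lam^(2) n = (2n a + b₂ + O(n^(-δ)))^(-B')`,
and the normalized eigenvectors satisfy `|⟪B (h n), h m⟫| ≤ c (n m)^(-(1+δ)/2)` for all `m`, `n`, then the eigenvalues of
the generalized eigenproblem `K 𝐡 = 𝛌 (𝐡 + B 𝐡)` are organized in two sequences with the
same two-term asymptotics. -/
theorem remark_two_seq_asymp_preserved_inner
    {H : Type*} [NormedAddCommGroup H] [InnerProductSpace ℝ H] [CompleteSpace H]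
    (K B : H →L[ℝ] H)
    (hKsa : IsSelfAdjoint K) (hBsa : IsSelfAdjoint B)
    (hKcomp : IsCompactOperator (⇑K)) (hBcomp : IsCompactOperator (⇑B))
    (hKpos : ∀ x : H, 0 ≤ ⟪K x, x⟫)
    (hIBpos : ∃ c₀ > (0 : ℝ), ∀ x : H, c₀ * ‖x‖ ^ 2 ≤ ⟪x + B x, x⟫)
    (a b₁ b₂ B' δ c : ℝ) (ha : 0 < a) (hB' : 0 < B') (hδ : 0 < δ) (hc : 0 < c)
    -- `lam` enumerates the eigenvalues of `K` in decreasing order with multiplicity;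
    -- `h` is a corresponding orthonormal basis of eigenvectors
    (lam : ℕ → ℝ) (h : ℕ → H)
    (hlpos : ∀ n, 0 < lam n) (hlanti : Antitone lam)
    (heig : ∀ n, K (h n) = lam n • h n)
    (hon : Orthonormal ℝ h)
    (hcomplete : (Submodule.span ℝ (Set.range h)).topologicalClosure = ⊤)
    -- the asymptotic and perturbation hypotheses
    (hlasymp : HasTwoSeqAsymp lam a b₁ b₂ B' δ)
    (hBh : ∀ n m, |⟪B (h n), h m⟫| ≤ c * (((n : ℝ) + 1) * ((m : ℝ) + 1)) ^ (-(1 + δ) / 2))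
    -- `mu` enumerates the eigenvalues of the generalized eigenproblem `K 𝐡 = 𝛌 (𝐡 + B 𝐡)`
    -- in decreasing order with multiplicity: `g` is a complete system of generalized
    -- eigenvectors, orthonormal with respect to the inner product `⟪x + B x, y⟫`
    (mu : ℕ → ℝ) (g : ℕ → H)
    (hmpos : ∀ n, 0 < mu n) (hmanti : Antitone mu)
    (hgeig : ∀ n, K (g n) = mu n • (g n + B (g n)))
    (hgon : ∀ n m, ⟪g n + B (g n), g m⟫ = if n = m then 1 else 0)
    (hgcomplete : (Submodule.span ℝ (Set.range g)).topologicalClosure = ⊤) :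
    HasTwoSeqAsymp mu a b₁ b₂ B' δ := by
  obtain ⟨c₀, hc₀, hpd⟩ := hIBpos
  have hpd' : ∀ x : H, x ≠ 0 → 0 < ⟪x + B x, x⟫ := fun x hx =>
    lt_of_lt_of_le (by have := norm_pos_iff.2 hx; positivity) (hpd x)
  obtain ⟨C, N, hC⟩ := hlasymp.exists_abs_rpow_sub_le ha hB' hδ
  set nu : ℕ → ℝ := fun n => lam n ^ (-B'⁻¹) with hnu
  have hnupos : ∀ n, 0 < nu n := fun n => Real.rpow_pos_of_pos (hlpos n) _
  have hnumono : Monotone nu := fun i j hij =>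
    Real.rpow_le_rpow_of_nonpos (hlpos j) (hlanti hij) (neg_nonpos.2 (inv_nonneg.2 hB'.le))
  have hlam : ∀ n, lam n = nu n ^ (-B') := fun n => by
    rw [hnu, ← Real.rpow_mul (hlpos n).le, neg_mul_neg, inv_mul_cancel₀ hB'.ne', Real.rpow_one]
  obtain ⟨M, L, hL, hM⟩ := exists_linear_growth_and_gap (nu := nu) ha hδ hC
  have hnulim : Tendsto nu atTop atTop := by
    refine tendsto_atTop_mono' atTop ?_ (tendsto_atTop_add_const_right atTop (-L)
      (tendsto_natCast_atTop_atTop.const_mul_atTop ha))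
    filter_upwards [eventually_ge_atTop M] with n hn using (hM n hn).2.1
  have hlim : Tendsto lam atTop (nhds 0) := by
    rw [show lam = (fun x : ℝ => x ^ (-B')) ∘ nu from funext hlam]
    exact (tendsto_rpow_neg_atTop hB').comp hnulim
  have hdecr : ∀ i k, M ≤ i → i + 2 ≤ k → lam k < lam i := fun i k hi hik => by
    rw [hlam, hlam]
    exact Real.rpow_lt_rpow_of_neg (hnupos i)
      (by linarith [(hM i hi).1, hnumono hik]) (by linarith)
  obtain ⟨D, N', hD⟩ := exists_abs_generalized_eigenvalue_sub_le K B hpd' hδ hc hlpos hlanti heig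
    hon hcomplete hBh hmanti hgeig hgon hgcomplete
    ⟨M + 2, fun n hn j hj => by
      rcases hj with hj | hj
      · rcases le_total M j with hMj | hMj
        · exact (hdecr j n hMj hj).ne'
        · exact ((hdecr M n le_rfl hn).trans_le (hlanti hMj)).ne'
      · exact (hdecr n j (by omega) hj).ne⟩
    (fun η hη => exists_far_sum_le (M₀ := M) (L := 3 * L / (min 1 B' * a)) hδ
      (by have : 0 < min 1 B' := lt_min one_pos hB'
          positivity) hlpos hlim
      (fun n j hn hj hnj => by
        simpa only [hlam] using rpow_neg_div_abs_sub_le ha hB' hnupos hnumono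
          (fun j hj => (hM j hj).1) (fun j hj => (hM j hj).2.2) hn hj hnj) hη)
  obtain ⟨E, hE, N'', hN''⟩ := exists_abs_rpow_sub_rpow_le (N := max M N') (q := -B'⁻¹) hδ hlpos
    hmpos (fun n hn => hD n ((le_max_right _ _).trans hn))
    (fun n hn => (hM n ((le_max_left _ _).trans hn)).2.2)
  have hclose : ∀ n k : ℕ, N'' ≤ n → n ≤ k →
      |mu k ^ (-B'⁻¹) - lam k ^ (-B'⁻¹)| ≤ E * ((n : ℝ) + 1) ^ (-δ) := by
    intro n k hn hnk
    refine (hN'' k (hn.trans hnk)).trans (mul_le_mul_of_nonneg_left ?_ hE)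
    have : (n : ℝ) ≤ k := by exact_mod_cast hnk
    exact Real.rpow_le_rpow_of_nonpos (by positivity) (by linarith) (by linarith)
  refine HasTwoSeqAsymp.of_abs_rpow_sub_le (C := E + C) (N := max N N'') hB' hmpos fun n hn => ?_
  obtain ⟨h₁, h₂⟩ := hC n ((le_max_left _ _).trans hn)
  have hn'' : N'' ≤ n := (le_max_right _ _).trans hn
  rw [add_mul E C]
  exact ⟨(abs_sub_le _ _ _).trans (add_le_add (hclose n (2 * n) hn'' (by omega)) h₁),
    (abs_sub_le _ _ _).trans (add_le_add (hclose n (2 * n + 1) hn'' (by omega)) h₂)⟩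
end

section
/- Let K and B be self-adjoint compact operators on a Hilbert space H, with K positive and I + B positive. Let λ_n denote the eigenvalues of K in decreasing order with multiplicity, with normalized eigenvectors h_n, and suppose there exist a, B̃, δ > 0, b ∈ ℝ, c > 0 with λ_n = (a n + b + O(n^{-δ}))^{-B̃} and ‖B h_n‖_H ≤ c n^{-(1+δ)}. Then there is a constant c_2 > 0 such that for every sufficiently large n the interval (λ_n(1 − c_2 n^{-(1+δ)}), λ_n(1 + c_2 n^{-(1+δ)})) contains at least one eigenvalue of the generalized eigenproblem K𝐡 = 𝛌(𝐡 + B𝐡). -/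
open scoped RealInnerProductSpace
open Filter

/-- `lam n = (a * n + b + O(n ^ (-δ)))^(-B')` as `n → ∞`, where the sequence is indexed
from `0`, so that `lam n` stands for the `(n+1)`-th term of the paper. -/
def HasTwoTermAsymp (lam : ℕ → ℝ) (a b B' δ : ℝ) : Prop :=
  ∃ (r : ℕ → ℝ) (C : ℝ) (N : ℕ),
    (∀ n, N ≤ n → |r n| ≤ C * ((n : ℝ) + 1) ^ (-δ)) ∧
    ∀ n, N ≤ n → lam n = (a * ((n : ℝ) + 1) + b + r n) ^ (-B')

/-- The Cauchy-Schwarz inequality for the semi-inner product of a positive operator. -/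
theorem norm_apply_sq_le_of_nonneg {H : Type*} [NormedAddCommGroup H] [InnerProductSpace ℝ H]
    {Q : H →L[ℝ] H} (hsymm : ∀ x y, ⟪Q x, y⟫ = ⟪x, Q y⟫) (hpos : ∀ x, 0 ≤ ⟪Q x, x⟫) (x : H) :
    ‖Q x‖ ^ 2 ≤ (‖Q‖ + 1) * ⟪Q x, x⟫ := by
  have hL : 0 < ‖Q‖ + 1 := by positivity
  have h₁ := hpos ((‖Q‖ + 1) • x - Q x)
  have h₂ : ⟪Q (Q x), Q x⟫ ≤ (‖Q‖ + 1) * ‖Q x‖ ^ 2 := by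
    have := real_inner_le_norm (Q (Q x)) (Q x)
    have := mul_le_mul_of_nonneg_right (Q.le_opNorm (Q x)) (norm_nonneg (Q x))
    nlinarith [sq_nonneg ‖Q x‖]
  have h₃ : ⟪Q (Q x), x⟫ = ‖Q x‖ ^ 2 := by rw [hsymm, real_inner_self_eq_norm_sq]
  simp only [map_sub, map_smul, inner_sub_left, inner_sub_right, real_inner_smul_left,
    real_inner_smul_right, h₃, real_inner_self_eq_norm_sq] at h₁
  have h₄ : 0 ≤ (‖Q‖ + 1) * ((‖Q‖ + 1) * ⟪Q x, x⟫ - ‖Q x‖ ^ 2) := by nlinarith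
  linarith [nonneg_of_mul_nonneg_right h₄ hL]

/-- If `W` is compact and symmetric for the inner product defined by a coercive operator `A`,
then every positive value of its Rayleigh quotient is at most some eigenvalue of `W`. -/
theorem exists_eigenvector_of_le_rayleigh {H : Type*} [NormedAddCommGroup H]
    [InnerProductSpace ℝ H] [CompleteSpace H] {A W : H →L[ℝ] H} {c₀ ν : ℝ} (hc₀ : 0 < c₀)
    (hA : ∀ x y, ⟪A x, y⟫ = ⟪x, A y⟫) (hAcoer : ∀ x, c₀ * ‖x‖ ^ 2 ≤ ⟪A x, x⟫)
    (hW : IsCompactOperator W) (hAW : ∀ x y, ⟪A (W x), y⟫ = ⟪x, A (W y)⟫)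
    (hν : 0 < ν) {u : H} (hu : u ≠ 0) (hle : ν * ⟪A u, u⟫ ≤ ⟪A (W u), u⟫) :
    ∃ μ, ν ≤ μ ∧ ∃ x, x ≠ 0 ∧ W x = μ • x := by
  have hApos : ∀ x, x ≠ 0 → 0 < ⟪A x, x⟫ := fun x hx =>
    lt_of_lt_of_le (by have := norm_pos_iff.2 hx; positivity) (hAcoer x)
  set S : Set ℝ := {μ | ∀ x, ⟪A (W x), x⟫ ≤ μ * ⟪A x, x⟫}
  have hSlb : ∀ x, x ≠ 0 → ∀ μ ∈ S, ⟪A (W x), x⟫ / ⟪A x, x⟫ ≤ μ := fun x hx μ hμ =>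
    (div_le_iff₀ (hApos x hx)).2 (hμ x)
  have hSne : S.Nonempty := by
    refine ⟨‖A ∘L W‖ / c₀, fun x => ?_⟩
    calc ⟪A (W x), x⟫ ≤ ‖(A ∘L W) x‖ * ‖x‖ := real_inner_le_norm _ _
      _ ≤ ‖A ∘L W‖ * ‖x‖ * ‖x‖ := by gcongr; exact (A ∘L W).le_opNorm x
      _ = ‖A ∘L W‖ / c₀ * (c₀ * ‖x‖ ^ 2) := by field_simp
      _ ≤ ‖A ∘L W‖ / c₀ * ⟪A x, x⟫ := by gcongr; exact hAcoer x
  have hSbdd : BddBelow S := ⟨_, fun μ hμ => hSlb u hu μ hμ⟩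
  set μ := sInf S
  have hμS : μ ∈ S := by
    intro x
    by_cases hx : x = 0
    · simp [hx]
    · exact (div_le_iff₀ (hApos x hx)).1 (le_csInf hSne (hSlb x hx))
  have hνμ : ν ≤ μ := ((le_div_iff₀ (hApos u hu)).2 hle).trans (le_csInf hSne (hSlb u hu))
  refine ⟨μ, hνμ, ?_⟩
  by_contra! hcon
  have hne : ¬ Module.End.HasEigenvalue (W : Module.End ℝ H) μ := by
    intro h
    obtain ⟨x, hx⟩ := h.exists_hasEigenvector
    exact hcon x hx.2 hx.apply_eq_smul
  have hanti := hW.antilipschitz_of_not_hasEigenvalue (hν.trans_le hνμ).ne' hne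
  rw [antilipschitzWith_iff_exists_mul_le_norm] at hanti
  obtain ⟨κ, hκ, hbound⟩ := hanti
  set Q : H →L[ℝ] H := μ • A - A ∘L W
  have hQapp : ∀ x, Q x = μ • A x - A (W x) := fun x => rfl
  have hQsymm : ∀ x y, ⟪Q x, y⟫ = ⟪x, Q y⟫ := fun x y => by
    simp only [hQapp, inner_sub_left, inner_sub_right, real_inner_smul_left,
      real_inner_smul_right, hA x y, hAW x y]
  have hQpos : ∀ x, 0 ≤ ⟪Q x, x⟫ := fun x => by
    simp only [hQapp, inner_sub_left, real_inner_smul_left]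
    linarith [hμS x]
  have hQlow : ∀ x, c₀ * κ * ‖x‖ ≤ ‖Q x‖ := by
    intro x
    set y := (W - μ • 1 : H →L[ℝ] H) x with hy
    have hQy : Q x = - A y := by simp [hQapp, hy]
    have h₁ : c₀ * ‖y‖ ≤ ‖A y‖ := by
      by_cases hy0 : y = 0
      · simp [hy0]
      · have := hAcoer y
        have h₂ := real_inner_le_norm (A y) y
        exact le_of_mul_le_mul_right (by nlinarith) (norm_pos_iff.2 hy0)
    rw [hQy, norm_neg, mul_assoc]
    exact le_trans (by gcongr; exact hbound x) h₁
  set η := (c₀ * κ) ^ 2 / ((‖Q‖ + 1) * (‖A‖ + 1)) with hη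
  have hηpos : 0 < η := by positivity
  have hmem : μ - η ∈ S := by
    intro x
    have h₁ := norm_apply_sq_le_of_nonneg hQsymm hQpos x
    have h₂ : (c₀ * κ * ‖x‖) ^ 2 ≤ ‖Q x‖ ^ 2 := by gcongr; exact hQlow x
    have h₃ : ⟪A x, x⟫ ≤ (‖A‖ + 1) * ‖x‖ ^ 2 := by
      have := real_inner_le_norm (A x) x
      have := mul_le_mul_of_nonneg_right (A.le_opNorm x) (norm_nonneg x)
      nlinarith [sq_nonneg ‖x‖]
    have h₄ : η * ⟪A x, x⟫ ≤ ⟪Q x, x⟫ := by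
      calc η * ⟪A x, x⟫ ≤ η * ((‖A‖ + 1) * ‖x‖ ^ 2) := by gcongr
        _ = (c₀ * κ * ‖x‖) ^ 2 / (‖Q‖ + 1) := by rw [hη]; field_simp
        _ ≤ ⟪Q x, x⟫ := by
          rw [div_le_iff₀ (by positivity)]
          linarith
    simp only [hQapp, inner_sub_left, real_inner_smul_left] at h₄
    linarith
  linarith [csInf_le hSbdd hmem]

/-- A symmetric compact `K` whose generalized residual `K u - l • A u` at some `u ≠ 0` is small
relative to `l * ‖u‖` has an eigenvalue relative to the coercive operator `A` near `l`. -/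
theorem exists_generalized_eigenvalue_near {H : Type*} [NormedAddCommGroup H]
    [InnerProductSpace ℝ H] [CompleteSpace H] {A K : H →L[ℝ] H} {c₀ l ε : ℝ} (hc₀ : 0 < c₀)
    (hA : ∀ x y, ⟪A x, y⟫ = ⟪x, A y⟫) (hAcoer : ∀ x, c₀ * ‖x‖ ^ 2 ≤ ⟪A x, x⟫)
    (hK : IsCompactOperator K) (hKsymm : ∀ x y, ⟪K x, y⟫ = ⟪x, K y⟫)
    (hε : 0 ≤ ε) (hεl : ε < l) {u : H} (hu : u ≠ 0)
    (hres : ‖K u - l • A u‖ ≤ c₀ * ε * ‖u‖) :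
    ∃ t, |t - l| ≤ ε ∧ ∃ x, x ≠ 0 ∧ K x = t • A x := by
  have hAunit : IsUnit A := by
    refine A.isUnit_of_forall_le_norm_inner_map (c := ⟨c₀, hc₀.le⟩) hc₀ fun x => ?_
    rw [Real.norm_eq_abs]
    refine le_trans (le_of_eq ?_) ((hAcoer x).trans (le_abs_self _))
    change ‖x‖ ^ 2 * c₀ = c₀ * ‖x‖ ^ 2
    ring
  obtain ⟨G, hAG⟩ : ∃ G : H →L[ℝ] H, ∀ x, A (G x) = x := by
    obtain ⟨U, hU⟩ := hAunit
    refine ⟨(U⁻¹ : (H →L[ℝ] H)ˣ), fun x => ?_⟩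
    rw [← hU, ← mul_apply_eq_comp, Units.mul_inv, one_apply_eq_self]
  set S : H →L[ℝ] H := G ∘L K
  have hAS : ∀ x, A (S x) = K x := fun x => hAG (K x)
  have hScomp : IsCompactOperator S := hK.clm_comp G
  set W : H →L[ℝ] H := (2 * l) • S - S ∘L S
  have hWapp : ∀ x, W x = (2 * l) • S x - S (S x) := fun x => rfl
  have hWcomp : IsCompactOperator W := (hScomp.smul (2 * l)).sub (hScomp.comp_clm S)
  have hASsymm : ∀ x y, ⟪K x, S y⟫ = ⟪S x, K y⟫ := fun x y => by
    rw [← hAS x, ← hAS y, hA]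
  have hAW : ∀ x y, ⟪A (W x), y⟫ = ⟪x, A (W y)⟫ := fun x y => by
    simp only [hWapp, map_sub, map_smul, hAS, inner_sub_left, inner_sub_right,
      real_inner_smul_left, real_inner_smul_right, hKsymm x y, hKsymm (S x) y]
    rw [← hASsymm, hKsymm]
  have hquad : ∀ x, ⟪A (W x), x⟫
      = l ^ 2 * ⟪A x, x⟫ - ⟪A (S x - l • x), S x - l • x⟫ := fun x => by
    have h₁ : ⟪A x, S x⟫ = ⟪K x, x⟫ := by rw [hA, hAS, real_inner_comm]
    simp only [hWapp, map_sub, map_smul, hAS, inner_sub_left, inner_sub_right,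
      real_inner_smul_left, real_inner_smul_right, h₁, hKsymm (S x) x]
    rw [hASsymm x x]
    ring
  have hAnonneg : ∀ x, 0 ≤ ⟪A x, x⟫ := fun x => le_trans (by positivity) (hAcoer x)
  have hApos : ∀ x, x ≠ 0 → 0 < ⟪A x, x⟫ := fun x hx =>
    lt_of_lt_of_le (by have := norm_pos_iff.2 hx; positivity) (hAcoer x)
  have hray : (l ^ 2 - ε ^ 2) * ⟪A u, u⟫ ≤ ⟪A (W u), u⟫ := by
    rw [hquad, sub_mul]
    refine sub_le_sub_left ?_ _
    set r := S u - l • u with hr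
    have hAr : A r = K u - l • A u := by simp [hr, hAS]
    have h₁ : ⟪A r, r⟫ ≤ c₀ * ε * ‖u‖ * ‖r‖ :=
      (real_inner_le_norm _ _).trans (by rw [hAr]; gcongr)
    have h₂ : ‖r‖ ≤ ε * ‖u‖ := by
      by_cases hr0 : r = 0
      · rw [hr0, norm_zero]; positivity
      · have hrpos := norm_pos_iff.2 hr0
        have h₃ := hAcoer r
        exact le_of_mul_le_mul_left (by nlinarith) (mul_pos hc₀ hrpos)
    calc ⟪A r, r⟫ ≤ c₀ * ε * ‖u‖ * (ε * ‖u‖) := h₁.trans (by gcongr)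
      _ = ε ^ 2 * (c₀ * ‖u‖ ^ 2) := by ring
      _ ≤ ε ^ 2 * ⟪A u, u⟫ := by gcongr; exact hAcoer u
  obtain ⟨μ, hμ, x, hx, hWx⟩ := exists_eigenvector_of_le_rayleigh hc₀ hA hAcoer hWcomp hAW
    (by nlinarith : 0 < l ^ 2 - ε ^ 2) hu hray
  have hm : 0 ≤ l ^ 2 - μ := by
    have h₁ := hquad x
    rw [hWx, map_smul, real_inner_smul_left] at h₁
    exact nonneg_of_mul_nonneg_left (by linarith [hAnonneg (S x - l • x)]) (hApos x hx)
  set s := √(l ^ 2 - μ)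
  have hs0 : 0 ≤ s := Real.sqrt_nonneg _
  have hsε : s ≤ ε := Real.sqrt_le_iff.2 ⟨hε, by linarith⟩
  have hss : s * s = l ^ 2 - μ := Real.mul_self_sqrt hm
  have hSS : S (S x) = (2 * l) • S x - (l ^ 2 - s * s) • x := by
    rw [hss, sub_sub_cancel, ← hWx, hWapp, sub_sub_cancel]
  by_cases hy : S x - (l - s) • x = 0
  · refine ⟨l - s, by rwa [sub_sub_cancel_left, abs_neg, abs_of_nonneg hs0], x, hx, ?_⟩
    rw [← hAS, sub_eq_zero.1 hy, map_smul]
  · refine ⟨l + s, by rwa [add_sub_cancel_left, abs_of_nonneg hs0], _, hy, ?_⟩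
    rw [← hAS, ← map_smul]
    congr 1
    rw [map_sub, map_smul, hSS]
    module

/-- Under the hypotheses of Lemma 1, there is a constant `c₂ > 0` such that for every
sufficiently large `n` the interval
`(lam n * (1 - c₂ n^(-(1+δ))), lam n * (1 + c₂ n^(-(1+δ))))` contains at least one
eigenvalue of the generalized eigenproblem `K 𝐡 = 𝛌 (𝐡 + B 𝐡)`. -/
theorem interval_contains_generalized_eigenvalue
    {H : Type*} [NormedAddCommGroup H] [InnerProductSpace ℝ H] [CompleteSpace H]
    (K B : H →L[ℝ] H)
    (hKsa : IsSelfAdjoint K) (hBsa : IsSelfAdjoint B)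
    (hKcomp : IsCompactOperator (⇑K)) (hBcomp : IsCompactOperator (⇑B))
    (hKpos : ∀ x : H, 0 ≤ ⟪K x, x⟫)
    (hIBpos : ∃ c₀ > (0 : ℝ), ∀ x : H, c₀ * ‖x‖ ^ 2 ≤ ⟪x + B x, x⟫)
    (a b B' δ c : ℝ) (ha : 0 < a) (hB' : 0 < B') (hδ : 0 < δ) (hc : 0 < c)
    -- `lam` enumerates the eigenvalues of `K` in decreasing order with multiplicity;
    -- `h` is a corresponding orthonormal basis of eigenvectors
    (lam : ℕ → ℝ) (h : ℕ → H)
    (hlpos : ∀ n, 0 < lam n) (hlanti : Antitone lam)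
    (heig : ∀ n, K (h n) = lam n • h n)
    (hon : Orthonormal ℝ h)
    (hcomplete : (Submodule.span ℝ (Set.range h)).topologicalClosure = ⊤)
    -- the asymptotic and perturbation hypotheses
    (hlasymp : HasTwoTermAsymp lam a b B' δ)
    (hBh : ∀ᶠ n in atTop, ‖B (h n)‖ ≤ c * ((n : ℝ) + 1) ^ (-(1 + δ))) :
    ∃ c₂ > (0 : ℝ), ∃ N : ℕ, ∀ n, N ≤ n → ∃ t : ℝ,
      lam n * (1 - c₂ * ((n : ℝ) + 1) ^ (-(1 + δ))) < t ∧
      t < lam n * (1 + c₂ * ((n : ℝ) + 1) ^ (-(1 + δ))) ∧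
      ∃ x : H, x ≠ 0 ∧ K x = t • (x + B x) := by
  obtain ⟨c₀, hc₀, hcoer⟩ := hIBpos
  have hrate : Tendsto (fun n : ℕ => c / c₀ * ((n : ℝ) + 1) ^ (-(1 + δ))) atTop (nhds 0) := by
    have h₁ : Tendsto (fun n : ℕ => (n : ℝ) + 1) atTop atTop :=
      tendsto_atTop_add_const_right _ _ tendsto_natCast_atTop_atTop
    simpa using ((tendsto_rpow_neg_atTop (by linarith : 0 < 1 + δ)).comp h₁).const_mul (c / c₀)
  obtain ⟨N, hN⟩ := eventually_atTop.1 (hBh.and (hrate.eventually (gt_mem_nhds one_pos)))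
  refine ⟨2 * (c / c₀), by positivity, N, fun n hn => ?_⟩
  obtain ⟨hBn, hsmall⟩ := hN n hn
  set p := ((n : ℝ) + 1) ^ (-(1 + δ))
  have hppos : 0 < p := by positivity
  have hl := hlpos n
  have hεpos : 0 < lam n * (c / c₀ * p) := by positivity
  have hnorm : ‖h n‖ = 1 := hon.1 n
  obtain ⟨t, ht, x, hx, hKx⟩ := exists_generalized_eigenvalue_near
    (A := ContinuousLinearMap.id ℝ H + B) (K := K) (l := lam n) (u := h n) hc₀
    (fun x y => by
      simp only [add_apply, ContinuousLinearMap.id_apply, inner_add_left,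
        inner_add_right]
      exact congrArg _ (hBsa.isSymmetric x y))
    (fun x => by rw [real_inner_comm, real_inner_comm]; exact hcoer x) hKcomp
    hKsa.isSymmetric hεpos.le
    (by nlinarith) (hon.ne_zero n) (by
      have h₁ : K (h n) - lam n • (ContinuousLinearMap.id ℝ H + B) (h n)
          = -(lam n • B (h n)) := by simp [heig]
      rw [h₁, norm_neg, norm_smul, Real.norm_of_nonneg hl.le, hnorm]
      calc lam n * ‖B (h n)‖ ≤ lam n * (c * p) := by gcongr
        _ = c₀ * (lam n * (c / c₀ * p)) * 1 := by field_simp)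
  obtain ⟨ht₁, ht₂⟩ := abs_le.1 ht
  exact ⟨t, by linarith, by linarith, x, hx, hKx⟩
end

section
/- Let K and B be self-adjoint compact operators on a Hilbert space H, with K positive and I + B positive. Write B = B_+ + B_−, where B_+ ≥ 0 and B_− ≤ 0 are the positive and negative parts of B. Let 𝛌_n, 𝛌_n^+, 𝛌_n^− denote respectively the decreasingly-enumerated eigenvalues (with multiplicity) of the generalized eigenproblems K𝐡 = 𝛌(𝐡 + B𝐡), K𝐡 = 𝛌(𝐡 + B_+𝐡), and K𝐡 = 𝛌(𝐡 + B_−𝐡). Then for every n, 𝛌_n^+ ≤ 𝛌_n ≤ 𝛌_n^−. -/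
open scoped RealInnerProductSpace

section GeneralizedEigenproblem

variable {H : Type*} [NormedAddCommGroup H] [InnerProductSpace ℝ H]

/-- The form `⟪A x, x⟫` is diagonal in an `A`-orthonormal family. -/
theorem inner_form_sum_eq_sum_sq {A : H →L[ℝ] H} {g : ℕ → H}
    (hon : ∀ n m, ⟪A (g n), g m⟫ = if n = m then 1 else 0) (s : Finset ℕ) (c : ℕ → ℝ) :
    ⟪A (∑ i ∈ s, c i • g i), ∑ i ∈ s, c i • g i⟫ = ∑ i ∈ s, c i ^ 2 := by
  simp only [map_sum, map_smul, sum_inner, inner_sum, real_inner_smul_left,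
    real_inner_smul_right, hon]
  refine Finset.sum_congr rfl fun i hi => ?_
  simp [hi, sq]

/-- The form `⟪K x, x⟫` is diagonal in an `A`-orthonormal family of solutions of
`K x = mu • A x`. -/
theorem inner_form_sum_eq_sum_mul_sq {K A : H →L[ℝ] H} {mu : ℕ → ℝ} {g : ℕ → H}
    (heig : ∀ n, K (g n) = mu n • A (g n))
    (hon : ∀ n m, ⟪A (g n), g m⟫ = if n = m then 1 else 0) (s : Finset ℕ) (c : ℕ → ℝ) :
    ⟪K (∑ i ∈ s, c i • g i), ∑ i ∈ s, c i • g i⟫ = ∑ i ∈ s, mu i * c i ^ 2 := by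
  simp only [map_sum, map_smul, sum_inner, inner_sum, real_inner_smul_left,
    real_inner_smul_right, heig, hon]
  refine Finset.sum_congr rfl fun i hi => ?_
  simp [hi]
  ring

/-- Upper bound for `⟪K x, x⟫` on the `A`-orthogonal complement of the first `n` generalized
eigenvectors. -/
theorem inner_le_mul_inner_of_forall_lt_inner_eq_zero {K A : H →L[ℝ] H} {mu : ℕ → ℝ}
    {g : ℕ → H} (hanti : Antitone mu)
    (heig : ∀ n, K (g n) = mu n • A (g n))
    (hon : ∀ n m, ⟪A (g n), g m⟫ = if n = m then 1 else 0)
    (hcomplete : (Submodule.span ℝ (Set.range g)).topologicalClosure = ⊤)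
    (n : ℕ) {x : H} (hx : ∀ i < n, ⟪A x, g i⟫ = 0) :
    ⟪K x, x⟫ ≤ mu n * ⟪A x, x⟫ := by
  let P : H → H := fun y => y - ∑ i ∈ Finset.range n, ⟪A y, g i⟫ • g i
  have hPcont : Continuous P := by fun_prop
  have hPx : P x = x := by
    have h : ∑ i ∈ Finset.range n, ⟪A x, g i⟫ • g i = 0 :=
      Finset.sum_eq_zero fun i hi => by rw [hx i (Finset.mem_range.1 hi), zero_smul]
    simp [P, h]
  have hclosed : IsClosed {y | ⟪K (P y), P y⟫ ≤ mu n * ⟪A (P y), P y⟫} :=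
    isClosed_le (by fun_prop) (by fun_prop)
  have hspan : (Submodule.span ℝ (Set.range g) : Set H) ⊆
      {y | ⟪K (P y), P y⟫ ≤ mu n * ⟪A (P y), P y⟫} := by
    intro y hy
    obtain ⟨c, rfl⟩ := Finsupp.mem_span_range_iff_exists_finsupp.1 hy
    have hP : P (c.sum fun i a => a • g i) = ∑ i ∈ c.support with n ≤ i, c i • g i := by
      have hcoef (j : ℕ) : ⟪A (c.sum fun i a => a • g i), g j⟫ = c j := by
        simp only [Finsupp.sum, map_sum, map_smul, sum_inner, real_inner_smul_left, hon]
        simp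
        exact fun h => h.symm
      have hlow : ∑ i ∈ c.support with ¬ n ≤ i, c i • g i
          = ∑ i ∈ Finset.range n, c i • g i := by
        refine Finset.sum_subset (fun i hi => by simp at hi ⊢; exact hi.2) fun i hi hi' => ?_
        have : c i = 0 := by
          by_contra h
          exact hi' (by simpa [h] using hi)
        rw [this, zero_smul]
      simp only [P, hcoef]
      rw [← hlow, sub_eq_iff_eq_add, Finset.sum_filter_add_sum_filter_not, Finsupp.sum]
    rw [Set.mem_ofPred_eq, hP, inner_form_sum_eq_sum_mul_sq heig hon,
      inner_form_sum_eq_sum_sq hon, Finset.mul_sum]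
    refine Finset.sum_le_sum fun i hi => ?_
    exact mul_le_mul_of_nonneg_right (hanti (Finset.mem_filter.1 hi).2) (sq_nonneg _)
  have hmem : x ∈ closure (Submodule.span ℝ (Set.range g) : Set H) := by
    rw [← Submodule.topologicalClosure_coe, hcomplete]
    trivial
  simpa only [Set.mem_ofPred_eq, hPx] using closure_minimal hspan hclosed hmem

/-- Generalized eigenvalues decrease as the form on the right-hand side increases. -/
theorem generalized_eigenvalue_le_of_form_le {K A A' : H →L[ℝ] H}
    (hle : ∀ x, ⟪A x, x⟫ ≤ ⟪A' x, x⟫)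
    {mu : ℕ → ℝ} {g : ℕ → H} (hpos : ∀ n, 0 < mu n) (hanti : Antitone mu)
    (heig : ∀ n, K (g n) = mu n • A (g n))
    (hon : ∀ n m, ⟪A (g n), g m⟫ = if n = m then 1 else 0)
    (hcomplete : (Submodule.span ℝ (Set.range g)).topologicalClosure = ⊤)
    {mu' : ℕ → ℝ} {g' : ℕ → H} (hanti' : Antitone mu')
    (heig' : ∀ n, K (g' n) = mu' n • A' (g' n))
    (hon' : ∀ n m, ⟪A' (g' n), g' m⟫ = if n = m then 1 else 0) (n : ℕ) :
    mu' n ≤ mu n := by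
  let L : (Fin (n + 1) → ℝ) →ₗ[ℝ] (Fin n → ℝ) := LinearMap.pi fun i =>
    ∑ j : Fin (n + 1), ⟪A (g' j), g i⟫ • LinearMap.proj j
  obtain ⟨c, hc, hc0⟩ := Submodule.exists_mem_ne_zero_of_ne_bot
    (L.ker_ne_bot_of_finrank_lt (by simp))
  let d : ℕ → ℝ := fun i => if h : i < n + 1 then c ⟨i, h⟩ else 0
  have hd (i : Fin (n + 1)) : d i = c i := dif_pos i.2
  set x : H := ∑ i ∈ Finset.range (n + 1), d i • g' i with hxdef
  have hxorth : ∀ i < n, ⟪A x, g i⟫ = 0 := by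
    intro i hi
    have h := congrFun (LinearMap.mem_ker.1 hc) ⟨i, hi⟩
    simp only [L, LinearMap.pi_apply, LinearMap.sum_apply, LinearMap.smul_apply,
      LinearMap.proj_apply, smul_eq_mul, Pi.zero_apply] at h
    rw [hxdef, Finset.sum_range]
    simp only [hd, map_sum, map_smul, sum_inner, real_inner_smul_left]
    simpa only [mul_comm] using h
  have hA' : ⟪A' x, x⟫ = ∑ i ∈ Finset.range (n + 1), d i ^ 2 :=
    inner_form_sum_eq_sum_sq hon' _ _
  have hA'pos : 0 < ⟪A' x, x⟫ := by
    obtain ⟨i, hi⟩ := Function.ne_iff.1 hc0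
    rw [hA']
    refine Finset.sum_pos' (fun _ _ => sq_nonneg _) ⟨i, Finset.mem_range.2 i.2, ?_⟩
    rw [hd]
    exact sq_pos_of_ne_zero hi
  have hlower : mu' n * ⟪A' x, x⟫ ≤ ⟪K x, x⟫ := by
    rw [hA', inner_form_sum_eq_sum_mul_sq heig' hon', Finset.mul_sum]
    refine Finset.sum_le_sum fun i hi => mul_le_mul_of_nonneg_right (hanti' ?_) (sq_nonneg _)
    exact Nat.lt_succ_iff.1 (Finset.mem_range.1 hi)
  refine le_of_mul_le_mul_right ?_ hA'pos
  calc mu' n * ⟪A' x, x⟫ ≤ ⟪K x, x⟫ := hlower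
    _ ≤ mu n * ⟪A x, x⟫ :=
      inner_le_mul_inner_of_forall_lt_inner_eq_zero hanti heig hon hcomplete n hxorth
    _ ≤ mu n * ⟪A' x, x⟫ := mul_le_mul_of_nonneg_left (hle x) (hpos n).le

end GeneralizedEigenproblem

/-- Let `K`, `B` be self-adjoint compact operators on a Hilbert space `H`, with `K` positive
and `I + B` positive.  Write `B = B₊ + B₋`, where `B₊ ≥ 0` and `B₋ ≤ 0` are the positive and
negative parts of `B` (so in particular `B₊ ∘ B₋ = 0`).  If `mu`, `mup`, `mum` enumerate in
decreasing order with multiplicity the eigenvalues of the generalized eigenproblems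
`K 𝐡 = 𝛌 (𝐡 + B 𝐡)`, `K 𝐡 = 𝛌 (𝐡 + B₊ 𝐡)` and `K 𝐡 = 𝛌 (𝐡 + B₋ 𝐡)` respectively,
then `mup n ≤ mu n ≤ mum n` for every `n`. -/
theorem generalized_eigenvalues_monotone_in_perturbation
    {H : Type*} [NormedAddCommGroup H] [InnerProductSpace ℝ H] [CompleteSpace H]
    (K B Bp Bm : H →L[ℝ] H)
    (hKsa : IsSelfAdjoint K) (hBsa : IsSelfAdjoint B)
    (hBpsa : IsSelfAdjoint Bp) (hBmsa : IsSelfAdjoint Bm)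
    (hKcomp : IsCompactOperator (⇑K)) (hBcomp : IsCompactOperator (⇑B))
    (hBpcomp : IsCompactOperator (⇑Bp)) (hBmcomp : IsCompactOperator (⇑Bm))
    (hKpos : ∀ x : H, 0 ≤ ⟪K x, x⟫)
    (hIBpos : ∃ c₀ > (0 : ℝ), ∀ x : H, c₀ * ‖x‖ ^ 2 ≤ ⟪x + B x, x⟫)
    -- `Bp` and `Bm` are the positive and negative parts of `B`
    (hdecomp : B = Bp + Bm)
    (hBppos : ∀ x : H, 0 ≤ ⟪Bp x, x⟫) (hBmneg : ∀ x : H, ⟪Bm x, x⟫ ≤ 0)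
    (hparts : Bp.comp Bm = 0)
    -- `mu` enumerates the eigenvalues of `K 𝐡 = 𝛌 (𝐡 + B 𝐡)` in decreasing order
    -- with multiplicity
    (mu : ℕ → ℝ) (g : ℕ → H)
    (hmpos : ∀ n, 0 < mu n) (hmanti : Antitone mu)
    (hgeig : ∀ n, K (g n) = mu n • (g n + B (g n)))
    (hgon : ∀ n m, ⟪g n + B (g n), g m⟫ = if n = m then 1 else 0)
    (hgcomplete : (Submodule.span ℝ (Set.range g)).topologicalClosure = ⊤)
    -- `mup` enumerates the eigenvalues of `K 𝐡 = 𝛌 (𝐡 + B₊ 𝐡)` in decreasing order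
    -- with multiplicity
    (mup : ℕ → ℝ) (gp : ℕ → H)
    (hmppos : ∀ n, 0 < mup n) (hmpanti : Antitone mup)
    (hgpeig : ∀ n, K (gp n) = mup n • (gp n + Bp (gp n)))
    (hgpon : ∀ n m, ⟪gp n + Bp (gp n), gp m⟫ = if n = m then 1 else 0)
    (hgpcomplete : (Submodule.span ℝ (Set.range gp)).topologicalClosure = ⊤)
    -- `mum` enumerates the eigenvalues of `K 𝐡 = 𝛌 (𝐡 + B₋ 𝐡)` in decreasing order
    -- with multiplicity
    (mum : ℕ → ℝ) (gm : ℕ → H)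
    (hmmpos : ∀ n, 0 < mum n) (hmmanti : Antitone mum)
    (hgmeig : ∀ n, K (gm n) = mum n • (gm n + Bm (gm n)))
    (hgmon : ∀ n m, ⟪gm n + Bm (gm n), gm m⟫ = if n = m then 1 else 0)
    (hgmcomplete : (Submodule.span ℝ (Set.range gm)).topologicalClosure = ⊤) :
    ∀ n, mup n ≤ mu n ∧ mu n ≤ mum n := by
  intro n
  constructor
  · refine generalized_eigenvalue_le_of_form_le (K := K) (A := .id ℝ H + B) (A' := .id ℝ H + Bp)
      (fun x => ?_) hmpos hmanti hgeig hgon hgcomplete hmpanti hgpeig hgpon n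
    simp only [hdecomp, add_apply, ContinuousLinearMap.id_apply,
      inner_add_left]
    linarith [hBmneg x]
  · refine generalized_eigenvalue_le_of_form_le (K := K) (A := .id ℝ H + Bm) (A' := .id ℝ H + B)
      (fun x => ?_) hmmpos hmmanti hgmeig hgmon hgmcomplete hmanti hgeig hgon n
    simp only [hdecomp, add_apply, ContinuousLinearMap.id_apply,
      inner_add_left]
    linarith [hBppos x]
end

section
/- Let K and B be self-adjoint compact operators on a Hilbert space H, with K positive, B positive, and hence I + B positive. Let λ_n be the eigenvalues of K in decreasing order with multiplicity, and 𝛌_n the eigenvalues of the generalized eigenproblem K𝐡 = 𝛌(𝐡 + B𝐡) in decreasing order with multiplicity. Then 𝛌_n ≤ λ_n for all n. Conversely, if B is negative (B ≤ 0) and I + B is positive, then 𝛌_n ≥ λ_n for all n. -/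
open scoped RealInnerProductSpace

/-- If `K f i = b i • T f i` and the `f i` are `T`-orthonormal, then the quadratic form of `K` is
diagonal on linear combinations of the `f i`. -/
lemma inner_map_sum_smul_of_generalized_eigenvectors
    {H ι : Type*} [NormedAddCommGroup H] [InnerProductSpace ℝ H] [DecidableEq ι]
    (K T : H →L[ℝ] H) (b : ι → ℝ) (f : ι → H)
    (heig : ∀ i, K (f i) = b i • T (f i))
    (hon : ∀ i j, ⟪T (f i), f j⟫ = if i = j then 1 else 0) (s : Finset ι) (c : ι → ℝ) :
    ⟪K (∑ i ∈ s, c i • f i), ∑ i ∈ s, c i • f i⟫ = ∑ i ∈ s, b i * c i ^ 2 := by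
  simp only [map_sum, map_smul, heig, sum_inner, inner_sum, real_inner_smul_left,
    real_inner_smul_right, hon]
  refine Finset.sum_congr rfl fun i hi => ?_
  simp [hi]
  ring

lemma inner_sum_smul_of_orthonormal_form
    {H ι : Type*} [NormedAddCommGroup H] [InnerProductSpace ℝ H] [DecidableEq ι]
    (T : H →L[ℝ] H) (f : ι → H)
    (hon : ∀ i j, ⟪T (f i), f j⟫ = if i = j then 1 else 0) (s : Finset ι) (c : ι → ℝ)
    {j : ι} (hj : j ∈ s) :
    ⟪T (∑ i ∈ s, c i • f i), f j⟫ = c j := by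
  simp [map_sum, sum_inner, real_inner_smul_left, hon, hj]

/-- The quadratic form of `K` is bounded by `b n` times that of `T` on vectors that are
`T`-orthogonal to the first `n` generalized eigenvectors. -/
lemma inner_map_le_of_orthogonal_generalized_eigenvectors
    {H : Type*} [NormedAddCommGroup H] [InnerProductSpace ℝ H]
    (K T : H →L[ℝ] H) (b : ℕ → ℝ) (f : ℕ → H) (hanti : Antitone b)
    (heig : ∀ n, K (f n) = b n • T (f n))
    (hon : ∀ n m, ⟪T (f n), f m⟫ = if n = m then 1 else 0)
    (hcomplete : (Submodule.span ℝ (Set.range f)).topologicalClosure = ⊤)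
    (n : ℕ) (x : H) (hx : ∀ i < n, ⟪T x, f i⟫ = 0) :
    ⟪K x, x⟫ ≤ b n * ⟪T x, x⟫ := by
  have key : ∀ y : H,
      ⟪K y, y⟫ ≤ b n * ⟪T y, y⟫ + ∑ i ∈ Finset.range n, (b i - b n) * ⟪T y, f i⟫ ^ 2 := by
    have hclosed : IsClosed {y : H |
        ⟪K y, y⟫ ≤ b n * ⟪T y, y⟫ + ∑ i ∈ Finset.range n, (b i - b n) * ⟪T y, f i⟫ ^ 2} :=
      isClosed_le (by fun_prop) (by fun_prop)
    have hdense : Dense (Submodule.span ℝ (Set.range f) : Set H) :=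
      Submodule.dense_iff_topologicalClosure_eq_top.mpr hcomplete
    refine fun y => hclosed.closure_subset_iff.mpr ?_ (hdense y)
    intro y hy
    obtain ⟨c, rfl⟩ := Finsupp.mem_span_range_iff_exists_finsupp.mp hy
    set s := c.support ∪ Finset.range n
    have hsum : (c.sum fun i a => a • f i) = ∑ i ∈ s, c i • f i :=
      Finsupp.sum_of_support_subset c Finset.subset_union_left _ (by simp)
    have hT := inner_map_sum_smul_of_generalized_eigenvectors T T 1 f (by simp) hon s c
    have hcoeff : ∑ i ∈ Finset.range n, (b i - b n) * ⟪T (∑ i ∈ s, c i • f i), f i⟫ ^ 2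
        = ∑ i ∈ Finset.range n, (b i - b n) * c i ^ 2 :=
      Finset.sum_congr rfl fun i hi => by
        rw [inner_sum_smul_of_orthonormal_form T f hon s c (Finset.mem_union_right _ hi)]
    rw [Set.mem_ofPred_eq, hsum, hcoeff, hT,
      inner_map_sum_smul_of_generalized_eigenvectors K T b f heig hon s c]
    have htail : ∑ i ∈ s, (b i - b n) * c i ^ 2 ≤ ∑ i ∈ Finset.range n, (b i - b n) * c i ^ 2 := by
      rw [← Finset.sum_sdiff (Finset.subset_union_right : Finset.range n ⊆ s)]
      refine add_le_of_nonpos_left (Finset.sum_nonpos fun i hi => ?_)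
      have hni : n ≤ i := by simpa using (Finset.mem_sdiff.mp hi).2
      exact mul_nonpos_of_nonpos_of_nonneg (sub_nonpos.mpr (hanti hni)) (sq_nonneg _)
    simp only [sub_mul, Finset.sum_sub_distrib, ← Finset.mul_sum] at htail ⊢
    simp only [Pi.one_apply, one_mul]
    linarith
  refine (key x).trans_eq ?_
  rw [Finset.sum_eq_zero fun i hi => by rw [hx i (Finset.mem_range.mp hi)]; ring, add_zero]

/-- Monotonicity of generalized eigenvalues: enlarging the form on the right-hand side of
`K x = a • S x` decreases the eigenvalues. -/
lemma generalized_eigenvalues_le_of_form_le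
    {H : Type*} [NormedAddCommGroup H] [InnerProductSpace ℝ H]
    (K S T : H →L[ℝ] H) (hTS : ∀ x, ⟪T x, x⟫ ≤ ⟪S x, x⟫)
    (a : ℕ → ℝ) (e : ℕ → H) (haanti : Antitone a)
    (haeig : ∀ n, K (e n) = a n • S (e n))
    (haon : ∀ n m, ⟪S (e n), e m⟫ = if n = m then 1 else 0)
    (b : ℕ → ℝ) (f : ℕ → H) (hb : ∀ n, 0 < b n) (hbanti : Antitone b)
    (hbeig : ∀ n, K (f n) = b n • T (f n))
    (hbon : ∀ n m, ⟪T (f n), f m⟫ = if n = m then 1 else 0)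
    (hbcomplete : (Submodule.span ℝ (Set.range f)).topologicalClosure = ⊤) (n : ℕ) :
    a n ≤ b n := by
  let L : (Fin (n + 1) → ℝ) →ₗ[ℝ] (Fin n → ℝ) :=
    LinearMap.pi fun j => (innerₗ H (f j)) ∘ₗ T.toLinearMap ∘ₗ
      Fintype.linearCombination ℝ fun i : Fin (n + 1) => e i
  obtain ⟨c, hc, hc0⟩ := (Submodule.ne_bot_iff _).mp
    (LinearMap.ker_ne_bot_of_finrank_lt (f := L) (by simp))
  have hon' : ∀ i j : Fin (n + 1), ⟪S (e i), e j⟫ = if i = j then 1 else 0 := by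
    simp [haon, Fin.ext_iff]
  have hK := inner_map_sum_smul_of_generalized_eigenvectors K S (fun i : Fin (n + 1) => a i)
    (fun i => e i) (fun i => haeig i) hon' Finset.univ c
  have hS := inner_map_sum_smul_of_generalized_eigenvectors S S 1
    (fun i : Fin (n + 1) => e i) (by simp) hon' Finset.univ c
  set x : H := ∑ i : Fin (n + 1), c i • e i
  have hx : ∀ i < n, ⟪T x, f i⟫ = 0 := fun i hi => by
    have := congrFun (LinearMap.mem_ker.mp hc) ⟨i, hi⟩
    rw [real_inner_comm]
    simpa [L, x, Fintype.linearCombination_apply, inner_sum, real_inner_smul_right] using this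
  have hupper := inner_map_le_of_orthogonal_generalized_eigenvectors K T b f hbanti hbeig hbon
    hbcomplete n x hx
  have hlower : a n * ⟪S x, x⟫ ≤ ⟪K x, x⟫ := by
    rw [hK, hS, Finset.mul_sum]
    refine Finset.sum_le_sum fun i _ => ?_
    rw [Pi.one_apply, one_mul]
    exact mul_le_mul_of_nonneg_right (haanti (Nat.lt_succ_iff.mp i.isLt)) (sq_nonneg _)
  have hpos : 0 < ⟪S x, x⟫ := by
    obtain ⟨i, hi⟩ := Function.ne_iff.mp hc0
    rw [hS]
    refine Finset.sum_pos' (fun i _ => by simp [sq_nonneg]) ⟨i, Finset.mem_univ i, ?_⟩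
    simpa using sq_pos_of_ne_zero hi
  have hmono := mul_le_mul_of_nonneg_left (hTS x) (hb n).le
  exact le_of_mul_le_mul_right (hlower.trans (hupper.trans hmono)) hpos

/-- Let `K`, `B` be self-adjoint compact operators on a Hilbert space `H`, with `K` positive
and `I + B` positive.  Let `lam` enumerate the eigenvalues of `K` in decreasing order with
multiplicity and let `mu` enumerate the eigenvalues of the generalized eigenproblem
`K 𝐡 = 𝛌 (𝐡 + B 𝐡)` in decreasing order with multiplicity.  If `B` is positive then
`mu n ≤ lam n` for all `n`; conversely, if `B` is negative then `lam n ≤ mu n` for all `n`. -/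
theorem generalized_eigenvalues_compare_of_sign
    {H : Type*} [NormedAddCommGroup H] [InnerProductSpace ℝ H] [CompleteSpace H]
    (K B : H →L[ℝ] H)
    (hKsa : IsSelfAdjoint K) (hBsa : IsSelfAdjoint B)
    (hKcomp : IsCompactOperator (⇑K)) (hBcomp : IsCompactOperator (⇑B))
    (hKpos : ∀ x : H, 0 ≤ ⟪K x, x⟫)
    (hIBpos : ∃ c₀ > (0 : ℝ), ∀ x : H, c₀ * ‖x‖ ^ 2 ≤ ⟪x + B x, x⟫)
    -- `lam` enumerates the eigenvalues of `K` in decreasing order with multiplicity;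
    -- `h` is a corresponding orthonormal basis of eigenvectors
    (lam : ℕ → ℝ) (h : ℕ → H)
    (hlpos : ∀ n, 0 < lam n) (hlanti : Antitone lam)
    (heig : ∀ n, K (h n) = lam n • h n)
    (hon : Orthonormal ℝ h)
    (hcomplete : (Submodule.span ℝ (Set.range h)).topologicalClosure = ⊤)
    -- `mu` enumerates the eigenvalues of the generalized eigenproblem `K 𝐡 = 𝛌 (𝐡 + B 𝐡)`
    -- in decreasing order with multiplicity
    (mu : ℕ → ℝ) (g : ℕ → H)
    (hmpos : ∀ n, 0 < mu n) (hmanti : Antitone mu)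
    (hgeig : ∀ n, K (g n) = mu n • (g n + B (g n)))
    (hgon : ∀ n m, ⟪g n + B (g n), g m⟫ = if n = m then 1 else 0)
    (hgcomplete : (Submodule.span ℝ (Set.range g)).topologicalClosure = ⊤) :
    ((∀ x : H, 0 ≤ ⟪B x, x⟫) → ∀ n, mu n ≤ lam n) ∧
    ((∀ x : H, ⟪B x, x⟫ ≤ 0) → ∀ n, lam n ≤ mu n) := by
  have hon' : ∀ n m, ⟪ContinuousLinearMap.id ℝ H (h n), h m⟫ = if n = m then 1 else 0 :=
    orthonormal_iff_ite.mp hon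
  refine ⟨fun hB => ?_, fun hB => ?_⟩
  · exact generalized_eigenvalues_le_of_form_le K (.id ℝ H + B) (.id ℝ H)
      (fun x => by simpa [inner_add_left] using hB x) mu g hmanti hgeig hgon
      lam h hlpos hlanti heig hon' hcomplete
  · exact generalized_eigenvalues_le_of_form_le K (.id ℝ H) (.id ℝ H + B)
      (fun x => by simpa [inner_add_left] using hB x) lam h hlanti heig hon'
      mu g hmpos hmanti hgeig hgon hgcomplete
end

section
/- Let K and B be self-adjoint compact operators on a Hilbert space H, with K positive and I + B positive. Let λ_n be the eigenvalues of K in decreasing order with multiplicity, with normalized eigenvectors h_n. Let V be a closed subspace of H spanned by a set of eigenvectors of K, and let x̂ ∈ V be a critical point (in particular a minimizer or maximizer) of the Rayleigh quotient J(x) = (Kx, x)_H / ((x, x)_H + (Bx, x)_H) over V \ {0}, restricted in the sense that the perturbation B is replaced by its compression P_V B P_V to V. Then for every index k with h_k ∈ V and λ_k ≠ J(x̂), one has (x̂, h_k)_H = [J(x̂) / (λ_k − J(x̂))] · (B x̂, h_k)_H. -/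
open scoped RealInnerProductSpace

/-- The quadratic form of a self-adjoint operator `T` has derivative `2 * ⟪T x, y⟫` at `x` in the
direction `y`. -/
theorem IsSelfAdjoint.hasDerivAt_inner_apply_self
    {H : Type*} [NormedAddCommGroup H] [InnerProductSpace ℝ H] [CompleteSpace H]
    {T : H →L[ℝ] H} (hT : IsSelfAdjoint T) (x y : H) :
    HasDerivAt (fun t : ℝ => ⟪T (x + t • y), x + t • y⟫) (2 * ⟪T x, y⟫) 0 := by
  have hline : HasDerivAt (fun t : ℝ => x + t • y) y 0 := by
    simpa using ((hasDerivAt_id (0 : ℝ)).smul_const y).const_add x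
  have hT_line : HasDerivAt (fun t : ℝ => T (x + t • y)) (T y) 0 :=
    T.hasFDerivAt.comp_hasDerivAt 0 hline
  have hsymm : ⟪T y, x⟫ = ⟪T x, y⟫ := by
    rw [real_inner_comm]
    exact (hT.isSymmetric x y).symm
  refine (hT_line.inner ℝ hline).congr_deriv ?_
  simp only [zero_smul, add_zero, hsymm]
  ring

/-- If the derivative of `⟪K x, x⟫ / ⟪A x, x⟫` at `x` in the direction `y` vanishes, then
`⟪K x, y⟫` is the value of the quotient at `x` times `⟪A x, y⟫`. -/
theorem inner_apply_eq_of_hasDerivAt_rayleigh_zero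
    {H : Type*} [NormedAddCommGroup H] [InnerProductSpace ℝ H] [CompleteSpace H]
    {K A : H →L[ℝ] H} (hK : IsSelfAdjoint K) (hA : IsSelfAdjoint A) {x y : H}
    (hx : ⟪A x, x⟫ ≠ 0)
    (hderiv : HasDerivAt
      (fun t : ℝ => ⟪K (x + t • y), x + t • y⟫ / ⟪A (x + t • y), x + t • y⟫) 0 0) :
    ⟪K x, y⟫ = ⟪K x, x⟫ / ⟪A x, x⟫ * ⟪A x, y⟫ := by
  have hquot := (hK.hasDerivAt_inner_apply_self x y).fun_div
    (hA.hasDerivAt_inner_apply_self x y) (by simpa using hx)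
  have hzero := hquot.unique hderiv
  simp only [zero_smul, add_zero, div_eq_zero_iff, pow_eq_zero_iff two_ne_zero, hx,
    or_false] at hzero
  field_simp
  linarith

/-- Let `K`, `B` be self-adjoint compact operators on a Hilbert space `H`, with `K` positive
and `I + B` positive, and let `lam n`, `h n` be the eigenvalues (in decreasing order with
multiplicity) and normalized eigenvectors of `K`.  Let `V` be a closed subspace spanned by a
set of eigenvectors of `K` and let `x'` be a critical point in `V \ {0}` of the Rayleigh
quotient `J x = ⟪K x, x⟫ / (⟪x, x⟫ + ⟪B x, x⟫)` restricted to `V` (along directions in `V`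
the compression `P_V B P_V` agrees with `B`, so this is the compressed Rayleigh quotient).
Then for every `k` with `h k ∈ V` and `lam k ≠ J x'`,
`⟪x', h k⟫ = (J x' / (lam k - J x')) * ⟪B x', h k⟫`. -/
theorem rayleigh_critical_point_identity
    {H : Type*} [NormedAddCommGroup H] [InnerProductSpace ℝ H] [CompleteSpace H]
    (K B : H →L[ℝ] H)
    (hKsa : IsSelfAdjoint K) (hBsa : IsSelfAdjoint B)
    (hKcomp : IsCompactOperator (⇑K)) (hBcomp : IsCompactOperator (⇑B))
    (hKpos : ∀ x : H, 0 ≤ ⟪K x, x⟫)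
    (hIBpos : ∃ c₀ > (0 : ℝ), ∀ x : H, c₀ * ‖x‖ ^ 2 ≤ ⟪x + B x, x⟫)
    -- `lam` enumerates the eigenvalues of `K` in decreasing order with multiplicity;
    -- `h` is a corresponding orthonormal basis of eigenvectors
    (lam : ℕ → ℝ) (h : ℕ → H)
    (hlpos : ∀ n, 0 < lam n) (hlanti : Antitone lam)
    (heig : ∀ n, K (h n) = lam n • h n)
    (hon : Orthonormal ℝ h)
    (hcomplete : (Submodule.span ℝ (Set.range h)).topologicalClosure = ⊤)
    -- the Rayleigh quotient
    (J : H → ℝ) (hJ : ∀ x, J x = ⟪K x, x⟫ / (⟪x, x⟫ + ⟪B x, x⟫))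
    -- `V` is a closed subspace spanned by a set of eigenvectors of `K`
    (V : Submodule ℝ H)
    (hVspan : ∃ S : Set ℕ, V = (Submodule.span ℝ (h '' S)).topologicalClosure)
    -- `x'` is a nonzero critical point of `J` on `V`: the derivative of `J` at `x'`
    -- vanishes along every direction in `V`
    (x' : H) (hx'V : x' ∈ V) (hx'ne : x' ≠ 0)
    (hcrit : ∀ y ∈ V, HasDerivAt (fun t : ℝ => J (x' + t • y)) 0 0) :
    ∀ k, h k ∈ V → lam k ≠ J x' →
      ⟪x', h k⟫ = J x' / (lam k - J x') * ⟪B x', h k⟫ := by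
  intro k hk hne
  have hform : ∀ x y : H, ⟪(1 + B) x, y⟫ = ⟪x, y⟫ + ⟪B x, y⟫ := fun x y => by
    simp [inner_add_left]
  have hden : ⟪(1 + B) x', x'⟫ ≠ 0 := by
    obtain ⟨c, hc, hbound⟩ := hIBpos
    have hpos : 0 < c * ‖x'‖ ^ 2 := by positivity
    exact (hpos.trans_le (by simpa using hbound x')).ne'
  have hderiv := hcrit (h k) hk
  simp only [hJ, ← hform] at hderiv
  have heuler := inner_apply_eq_of_hasDerivAt_rayleigh_zero hKsa
    ((IsSelfAdjoint.one (H →L[ℝ] H)).add hBsa) hden hderiv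
  have hKx : ⟪K x', h k⟫ = lam k * ⟪x', h k⟫ := by
    rw [← real_inner_smul_right, ← heig k]
    exact hKsa.isSymmetric x' (h k)
  rw [hKx, hform, hform, ← hJ] at heuler
  have hsub : lam k - J x' ≠ 0 := sub_ne_zero.mpr hne
  field_simp
  linarith
end

section
/- Let B̃ > 0 and δ > 0. Then there exists a constant C > 0 such that for all integers n ≥ 2, n^{-δ} ∫_{1/n}^{1 − 1/n} t^{B̃ − 1 − δ} / (1 − t^{B̃}) dt ≤ C log(n) / n^{min{1, δ, B̃}}. -/
theorem integral_inv_add_inv_one_sub {a b : ℝ} (ha : 0 < a) (hab : a ≤ b) (hb : b < 1) :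
    ∫ t in a..b, (t⁻¹ + (1 - t)⁻¹) =
      (Real.log b - Real.log (1 - b)) - (Real.log a - Real.log (1 - a)) := by
  refine intervalIntegral.integral_eq_sub_of_hasDerivAt (f := fun t => Real.log t - Real.log (1 - t)) ?_ ?_
  · intro t ht
    rw [Set.uIcc_of_le hab] at ht
    have h0 : t ≠ 0 := by linarith [ht.1]
    have h1 : 1 - t ≠ 0 := by linarith [ht.2]
    refine ((Real.hasDerivAt_log h0).fun_sub
      (((hasDerivAt_id' t).const_sub 1).log h1)).congr_deriv ?_
    ring
  · refine ContinuousOn.intervalIntegrable fun t ht => ContinuousAt.continuousWithinAt ?_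
    rw [Set.uIcc_of_le hab] at ht
    have h0 : t ≠ 0 := by linarith [ht.1]
    have h1 : 1 - t ≠ 0 := by linarith [ht.2]
    fun_prop (disch := assumption)

theorem min_one_mul_one_sub_le_one_sub_rpow_s14 {B t : ℝ} (hB : 0 < B) (h0 : 0 < t) (h1 : t ≤ 1) :
    min 1 B * (1 - t) ≤ 1 - t ^ B := by
  have hpow : t ^ B ≤ t ^ min 1 B :=
    Real.rpow_le_rpow_of_exponent_ge h0 h1 (min_le_right _ _)
  have hbern := rpow_one_add_le_one_add_mul_self (s := t - 1) (p := min 1 B)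
    (by linarith) (by positivity) (min_le_left _ _)
  rw [add_sub_cancel] at hbern
  linarith

theorem rpow_mul_rpow_le_inv {B δ m x t : ℝ} (hmδ : m ≤ δ) (hmB : m ≤ B) (hx : 0 < x)
    (h0 : 0 < t) (h1 : t ≤ 1) (hxt : 1 ≤ x * t) :
    x ^ (m - δ) * t ^ (B - 1 - δ) ≤ t⁻¹ := by
  have hsplit : x ^ (m - δ) * t ^ (B - 1 - δ) = (x * t) ^ (m - δ) * t ^ (B - m) * t⁻¹ := by
    rw [Real.mul_rpow hx.le h0.le, ← Real.rpow_neg_one t, mul_assoc, mul_assoc,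
      ← Real.rpow_add h0, ← Real.rpow_add h0]
    ring_nf
  have hleft : (x * t) ^ (m - δ) ≤ 1 :=
    Real.rpow_le_one_of_one_le_of_nonpos hxt (by linarith)
  have hright : t ^ (B - m) ≤ 1 := Real.rpow_le_one h0.le h1 (by linarith)
  rw [hsplit]
  exact mul_le_of_le_one_left (by positivity)
    (mul_le_one₀ hleft (by positivity) hright)

/-- For `B' > 0` and `δ > 0` there is a constant `C > 0` such that for all integers `n ≥ 2`,
`n^(-δ) * ∫_{1/n}^{1 - 1/n} t^(B'-1-δ) / (1 - t^B') dt ≤ C log n / n^(min {1, δ, B'})`. -/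
theorem integral_bound_lower_range (B' δ : ℝ) (hB' : 0 < B') (hδ : 0 < δ) :
    ∃ C > (0 : ℝ), ∀ n : ℕ, 2 ≤ n →
      (n : ℝ) ^ (-δ) *
          ∫ t in (1 / (n : ℝ))..(1 - 1 / (n : ℝ)), t ^ (B' - 1 - δ) / (1 - t ^ B') ≤
        C * Real.log n / (n : ℝ) ^ min 1 (min δ B') := by
  refine ⟨2 / min 1 B', by positivity, fun n hn => ?_⟩
  have hn2 : (2 : ℝ) ≤ n := by exact_mod_cast hn
  have hn0 : (0 : ℝ) < n := by linarith
  set m := min 1 (min δ B')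
  have hmδ : m ≤ δ := (min_le_right _ _).trans (min_le_left _ _)
  have hmB : m ≤ B' := (min_le_right _ _).trans (min_le_right _ _)
  have ha : 0 < 1 / (n : ℝ) := by positivity
  have hhalf : 1 / (n : ℝ) ≤ 1 / 2 := one_div_le_one_div_of_le two_pos hn2
  have hab : 1 / (n : ℝ) ≤ 1 - 1 / n := by linarith
  have hden {t : ℝ} (ht : t ∈ Set.Icc (1 / (n : ℝ)) (1 - 1 / n)) : 0 < 1 - t ^ B' :=
    sub_pos.2 (Real.rpow_lt_one (by linarith [ht.1]) (by linarith [ht.2]) hB')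
  rw [le_div_iff₀ (by positivity), mul_right_comm, mul_comm ((n : ℝ) ^ (-δ)),
    ← Real.rpow_add hn0, ← sub_eq_add_neg, ← intervalIntegral.integral_const_mul]
  calc ∫ t in (1 / (n : ℝ))..(1 - 1 / n),
        (n : ℝ) ^ (m - δ) * (t ^ (B' - 1 - δ) / (1 - t ^ B'))
      ≤ ∫ t in (1 / (n : ℝ))..(1 - 1 / n), (min 1 B')⁻¹ * (t⁻¹ + (1 - t)⁻¹) := by
        refine intervalIntegral.integral_mono_on hab ?_ ?_ fun t ht => ?_
        · refine ContinuousOn.intervalIntegrable fun t ht => ContinuousAt.continuousWithinAt ?_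
          rw [Set.uIcc_of_le hab] at ht
          have h0 : t ≠ 0 := by linarith [ht.1]
          exact continuousAt_const.mul ((Real.continuousAt_rpow_const _ _ (Or.inl h0)).div
            (continuousAt_const.sub (Real.continuousAt_rpow_const _ _ (Or.inl h0)))
            (hden ht).ne')
        · refine ContinuousOn.intervalIntegrable fun t ht => ContinuousAt.continuousWithinAt ?_
          rw [Set.uIcc_of_le hab] at ht
          have h0 : t ≠ 0 := by linarith [ht.1]
          have h1 : 1 - t ≠ 0 := by linarith [ht.2]
          fun_prop (disch := assumption)
        · have h0 : 0 < t := ha.trans_le ht.1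
          have h1 : 0 < 1 - t := by linarith [ht.2]
          have hnt : 1 ≤ n * t := (div_le_iff₀' hn0).1 ht.1
          calc (n : ℝ) ^ (m - δ) * (t ^ (B' - 1 - δ) / (1 - t ^ B'))
              = (n : ℝ) ^ (m - δ) * t ^ (B' - 1 - δ) / (1 - t ^ B') := by ring
            _ ≤ t⁻¹ / (min 1 B' * (1 - t)) := by
                gcongr
                · exact rpow_mul_rpow_le_inv hmδ hmB hn0 h0 (by linarith) hnt
                · exact min_one_mul_one_sub_le_one_sub_rpow_s14 hB' h0 (by linarith)
            _ = (min 1 B')⁻¹ * (t⁻¹ + (1 - t)⁻¹) := by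
                field_simp
                ring
    _ = (min 1 B')⁻¹ * (2 * (Real.log (1 - 1 / n) + Real.log n)) := by
        rw [intervalIntegral.integral_const_mul,
          integral_inv_add_inv_one_sub ha hab (by linarith), sub_sub_cancel, one_div,
          Real.log_inv]
        ring
    _ ≤ (min 1 B')⁻¹ * (2 * Real.log n) := by
        have hlog : Real.log (1 - 1 / n) ≤ 0 :=
          Real.log_nonpos (by linarith) (by linarith)
        gcongr
        linarith
    _ = 2 / min 1 B' * Real.log n := by ring
end

section
/- Let B̃ > 0 and δ > 0. Then there exists a constant C > 0 such that for all integers n ≥ 2, the integral ∫_{1 + 1/n}^{∞} t^{B̃ − 1 − δ} / (t^{B̃} − 1) dt converges and satisfies n^{-δ} ∫_{1 + 1/n}^{∞} t^{B̃ − 1 − δ} / (t^{B̃} − 1) dt ≤ C log(n) / n^{min{1, δ, B̃}}. -/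
open MeasureTheory

/-- Bernoulli-type bound: on `(0, 1]`, `1 - u ^ b` dominates `min 1 b` times `1 - u`. -/
lemma min_one_mul_one_sub_le_one_sub_rpow_s15 {b u : ℝ} (hb : 0 < b) (hu : 0 < u) (hu1 : u ≤ 1) :
    min 1 b * (1 - u) ≤ 1 - u ^ b := by
  rcases le_total 1 b with h | h
  · have := Real.rpow_le_rpow_of_exponent_ge hu hu1 h
    rw [Real.rpow_one] at this
    rw [min_eq_left h]
    linarith
  · have := rpow_one_add_le_one_add_mul_self (s := u - 1) (by linarith) hb.le h
    rw [min_eq_right h]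
    rw [add_sub_cancel] at this
    linarith

lemma rpow_div_rpow_sub_one_le {b δ t : ℝ} (hb : 0 < b) (ht : 1 < t) :
    t ^ (b - 1 - δ) / (t ^ b - 1) ≤ (min 1 b)⁻¹ * (t ^ (-δ) / (t - 1)) := by
  have ht0 : 0 < t := by linarith
  have hc : 0 < min 1 b := lt_min one_pos hb
  have h := min_one_mul_one_sub_le_one_sub_rpow_s15 hb (inv_pos.2 ht0) (inv_le_one_of_one_le₀ ht.le)
  have htb : 0 < t ^ b := Real.rpow_pos_of_pos ht0 _
  have htb1 : 0 < t ^ b - 1 := sub_pos.2 (Real.one_lt_rpow ht hb)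
  have hd : 0 < t ^ (-δ) := Real.rpow_pos_of_pos ht0 _
  have he : t ^ (b - 1 - δ) = t ^ b * t⁻¹ * t ^ (-δ) := by
    rw [← Real.rpow_neg_one, ← Real.rpow_add ht0, ← Real.rpow_add ht0]
    ring_nf
  have hmul : min 1 b * (t - 1) * (t ^ b * t⁻¹) ≤ t ^ b - 1 := by
    rw [Real.inv_rpow ht0.le] at h
    have h2 := mul_le_mul_of_nonneg_left h htb.le
    calc min 1 b * (t - 1) * (t ^ b * t⁻¹) = t ^ b * (min 1 b * (1 - t⁻¹)) := by field_simp
      _ ≤ t ^ b * (1 - (t ^ b)⁻¹) := h2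
      _ = t ^ b - 1 := by field_simp
  have ht1 : 0 < t - 1 := by linarith
  rw [he, ← div_eq_inv_mul, div_div, div_le_div_iff₀ htb1 (by positivity)]
  calc t ^ b * t⁻¹ * t ^ (-δ) * ((t - 1) * min 1 b)
      = t ^ (-δ) * (min 1 b * (t - 1) * (t ^ b * t⁻¹)) := by ring
    _ ≤ _ := mul_le_mul_of_nonneg_left hmul hd.le

lemma continuousOn_rpow_div_rpow_sub_one {b : ℝ} (e : ℝ) (hb : 0 < b) :
    ContinuousOn (fun t : ℝ => t ^ e / (t ^ b - 1)) (Set.Ioi 1) := by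
  intro t ht
  have ht : 1 < t := ht
  have ht0 : t ≠ 0 := by linarith
  have h1 : t ^ b - 1 ≠ 0 := (sub_pos.2 (Real.one_lt_rpow ht hb)).ne'
  exact ((Real.continuousAt_rpow_const t e (Or.inl ht0)).div
    ((Real.continuousAt_rpow_const t b (Or.inl ht0)).sub continuousAt_const) h1).continuousWithinAt

lemma rpow_div_rpow_sub_one_nonneg {b t : ℝ} (e : ℝ) (hb : 0 < b) (ht : 1 < t) :
    0 ≤ t ^ e / (t ^ b - 1) :=
  div_nonneg (Real.rpow_nonneg (by linarith) _) (sub_pos.2 (Real.one_lt_rpow ht hb)).le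

lemma integrableOn_and_setIntegral_Ioi_two_le {b δ : ℝ} (hb : 0 < b) (hδ : 0 < δ) :
    IntegrableOn (fun t : ℝ => t ^ (b - 1 - δ) / (t ^ b - 1)) (Set.Ioi 2) ∧
      ∫ t in Set.Ioi (2 : ℝ), t ^ (b - 1 - δ) / (t ^ b - 1) ≤ (min 1 b)⁻¹ * (2 / δ) := by
  have hc : 0 < min 1 b := lt_min one_pos hb
  have hlt : -1 - δ < -1 := by linarith
  have hg : IntegrableOn (fun t : ℝ => (min 1 b)⁻¹ * (2 * t ^ (-1 - δ))) (Set.Ioi 2) :=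
    ((integrableOn_Ioi_rpow_of_lt hlt two_pos).const_mul 2).const_mul _
  have hle : ∀ t ∈ Set.Ioi (2 : ℝ),
      t ^ (b - 1 - δ) / (t ^ b - 1) ≤ (min 1 b)⁻¹ * (2 * t ^ (-1 - δ)) := by
    intro t ht
    have ht : 2 < t := ht
    have ht0 : 0 < t := by linarith
    refine (rpow_div_rpow_sub_one_le hb (by linarith)).trans
      (mul_le_mul_of_nonneg_left ?_ (inv_pos.2 hc).le)
    have hd : 0 < t ^ (-δ) := Real.rpow_pos_of_pos ht0 _
    have he : t ^ (-1 - δ) = t⁻¹ * t ^ (-δ) := by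
      rw [← Real.rpow_neg_one, ← Real.rpow_add ht0]
      ring_nf
    rw [he, div_le_iff₀ (by linarith)]
    have h1 : 1 ≤ 2 * t⁻¹ * (t - 1) := by
      rw [← div_eq_mul_inv, div_mul_eq_mul_div, le_div_iff₀ ht0]
      linarith
    nlinarith
  have hf : IntegrableOn (fun t : ℝ => t ^ (b - 1 - δ) / (t ^ b - 1)) (Set.Ioi 2) := by
    refine Integrable.mono' hg (((continuousOn_rpow_div_rpow_sub_one _ hb).mono
      (Set.Ioi_subset_Ioi one_le_two)).aestronglyMeasurable measurableSet_Ioi) ?_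
    refine (ae_restrict_iff' measurableSet_Ioi).2 (Filter.Eventually.of_forall fun t ht => ?_)
    rw [Real.norm_of_nonneg
      (rpow_div_rpow_sub_one_nonneg _ hb (one_lt_two.trans ht))]
    exact hle t ht
  refine ⟨hf, (setIntegral_mono_on hf hg measurableSet_Ioi hle).trans ?_⟩
  rw [integral_const_mul, integral_const_mul, integral_Ioi_rpow_of_lt hlt two_pos]
  refine mul_le_mul_of_nonneg_left ?_ (inv_pos.2 hc).le
  have h2 : (2 : ℝ) ^ (-δ) ≤ 1 := Real.rpow_le_one_of_one_le_of_nonpos one_le_two (by linarith)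
  have he : -1 - δ + 1 = -δ := by ring
  rw [he, neg_div_neg_eq, mul_div_assoc']
  gcongr
  linarith

lemma integrableOn_and_setIntegral_Ioc_le {b δ a : ℝ} (hb : 0 < b) (hδ : 0 < δ)
    (ha : 1 < a) (ha2 : a ≤ 2) :
    IntegrableOn (fun t : ℝ => t ^ (b - 1 - δ) / (t ^ b - 1)) (Set.Ioc a 2) ∧
      ∫ t in Set.Ioc a 2, t ^ (b - 1 - δ) / (t ^ b - 1) ≤
        (min 1 b)⁻¹ * Real.log (a - 1)⁻¹ := by
  have hc : 0 < min 1 b := lt_min one_pos hb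
  have hf : IntegrableOn (fun t : ℝ => t ^ (b - 1 - δ) / (t ^ b - 1)) (Set.Ioc a 2) :=
    (((continuousOn_rpow_div_rpow_sub_one _ hb).mono
      fun t ht => ha.trans_le ht.1).integrableOn_Icc).mono_set Set.Ioc_subset_Icc_self
  have hg : IntegrableOn (fun t : ℝ => (min 1 b)⁻¹ * (t - 1)⁻¹) (Set.Ioc a 2) := by
    refine (ContinuousOn.integrableOn_Icc ?_).mono_set Set.Ioc_subset_Icc_self
    refine continuousOn_const.mul ((continuousOn_id.sub continuousOn_const).inv₀ fun t ht => ?_)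
    exact (sub_pos.2 (ha.trans_le ht.1)).ne'
  refine ⟨hf, (setIntegral_mono_on hf hg measurableSet_Ioc fun t ht => ?_).trans ?_⟩
  · have ht1 : 1 < t := ha.trans ht.1
    refine (rpow_div_rpow_sub_one_le hb ht1).trans
      (mul_le_mul_of_nonneg_left ?_ (inv_pos.2 hc).le)
    rw [div_eq_mul_inv]
    exact mul_le_of_le_one_left (inv_nonneg.2 (by linarith))
      (Real.rpow_le_one_of_one_le_of_nonpos ht1.le (by linarith))
  · rw [integral_const_mul, ← intervalIntegral.integral_of_le ha2,
      intervalIntegral.integral_comp_sub_right (fun x : ℝ => x⁻¹) 1,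
      integral_inv_of_pos (by linarith) (by norm_num)]
    norm_num

/-- For `B' > 0` and `δ > 0` there is a constant `C > 0` such that for all integers `n ≥ 2`,
the integral `∫_{1 + 1/n}^{∞} t^(B'-1-δ) / (t^B' - 1) dt` converges and
`n^(-δ) * ∫_{1 + 1/n}^{∞} t^(B'-1-δ) / (t^B' - 1) dt ≤ C log n / n^(min {1, δ, B'})`. -/
theorem integral_bound_upper_range (B' δ : ℝ) (hB' : 0 < B') (hδ : 0 < δ) :
    ∃ C > (0 : ℝ), ∀ n : ℕ, 2 ≤ n →
      IntegrableOn (fun t : ℝ => t ^ (B' - 1 - δ) / (t ^ B' - 1))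
          (Set.Ioi (1 + 1 / (n : ℝ))) ∧
      (n : ℝ) ^ (-δ) *
          ∫ t in Set.Ioi (1 + 1 / (n : ℝ)), t ^ (B' - 1 - δ) / (t ^ B' - 1) ≤
        C * Real.log n / (n : ℝ) ^ min 1 (min δ B') := by
  have hc : 0 < min 1 B' := lt_min one_pos hB'
  have hl2 : 0 < Real.log 2 := Real.log_pos one_lt_two
  refine ⟨(min 1 B')⁻¹ * (1 + 2 / δ / Real.log 2), by positivity, fun n hn => ?_⟩
  have hn2 : (2 : ℝ) ≤ n := by exact_mod_cast hn
  have hn0 : (0 : ℝ) < n := by linarith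
  have hln : Real.log 2 ≤ Real.log n := Real.log_le_log two_pos hn2
  have ha : 1 < 1 + 1 / (n : ℝ) := lt_add_of_pos_right _ (by positivity)
  have ha2 : 1 + 1 / (n : ℝ) ≤ 2 := by
    have : 1 / (n : ℝ) ≤ 1 := (div_le_one hn0).2 (by linarith)
    linarith
  obtain ⟨hi1, hb1⟩ := integrableOn_and_setIntegral_Ioc_le hB' hδ ha ha2
  obtain ⟨hi2, hb2⟩ := integrableOn_and_setIntegral_Ioi_two_le hB' hδ
  rw [add_sub_cancel_left, one_div, inv_inv, ← one_div] at hb1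
  rw [← Set.Ioc_union_Ioi_eq_Ioi ha2]
  refine ⟨hi1.union hi2, ?_⟩
  rw [setIntegral_union (Set.Ioc_disjoint_Ioi le_rfl) measurableSet_Ioi hi1 hi2]
  have hlog : 2 / δ ≤ 2 / δ / Real.log 2 * Real.log n := by
    rw [div_mul_eq_mul_div, le_div_iff₀ hl2]
    exact mul_le_mul_of_nonneg_left hln (by positivity)
  have hpow : (n : ℝ) ^ (-δ) ≤ ((n : ℝ) ^ min 1 (min δ B'))⁻¹ := by
    rw [← Real.rpow_neg hn0.le]
    exact Real.rpow_le_rpow_of_exponent_le (by linarith)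
      (neg_le_neg ((min_le_right _ _).trans (min_le_left _ _)))
  have hlogn : 0 < Real.log n := hl2.trans_le hln
  calc _ ≤ (n : ℝ) ^ (-δ) * ((min 1 B')⁻¹ * (1 + 2 / δ / Real.log 2) * Real.log n) := by
        refine mul_le_mul_of_nonneg_left ?_ (Real.rpow_nonneg hn0.le _)
        have := mul_le_mul_of_nonneg_left hlog (inv_pos.2 hc).le
        linarith
    _ ≤ ((n : ℝ) ^ min 1 (min δ B'))⁻¹ *
          ((min 1 B')⁻¹ * (1 + 2 / δ / Real.log 2) * Real.log n) :=
        mul_le_mul_of_nonneg_right hpow (by positivity)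
    _ = _ := (div_eq_inv_mul _ _).symm
end

section
/- Let δ > 0 and c > 0. Let n be a positive integer and let a_1, …, a_n be nonnegative reals with a_n > 0 satisfying, for every 1 ≤ k ≤ n−1, the inequality a_k ≤ ε_n · Σ_{m=1}^{n} a_m · c (k m)^{-(1+δ)/2}, where ε_n ≥ 0. Set A = Σ_{k=1}^{n} a_k k^{-(1+δ)/2} and 𝔠_n = ε_n · c · Σ_{k=1}^{n−1} k^{-(1+δ)}. If 𝔠_n ≤ 1/2, then A ≤ 2 a_n n^{-(1+δ)/2}. -/
/-- The key bookkeeping inequality of Theorem 1: if nonnegative numbers `a 1, …, a n` with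
`a n > 0` satisfy `a k ≤ ε * ∑_{m=1}^{n} a m * c (k m)^(-(1+δ)/2)` for `1 ≤ k ≤ n - 1`, and
if `𝔠 = ε * c * ∑_{k=1}^{n-1} k^(-(1+δ)) ≤ 1/2`, then
`A = ∑_{k=1}^{n} a k * k^(-(1+δ)/2) ≤ 2 * a n * n^(-(1+δ)/2)`. -/
theorem weighted_sum_self_improving
    (δ c : ℝ) (hδ : 0 < δ) (hc : 0 < c)
    (n : ℕ) (hn : 1 ≤ n) (a : ℕ → ℝ) (ε : ℝ) (hε : 0 ≤ ε)
    (ha : ∀ k, 0 ≤ a k) (han : 0 < a n)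
    (hrec : ∀ k, 1 ≤ k → k < n →
      a k ≤ ε * ∑ m ∈ Finset.Icc 1 n, a m * (c * ((k : ℝ) * m) ^ (-(1 + δ) / 2)))
    (hsmall : ε * c * ∑ k ∈ Finset.Ico 1 n, (k : ℝ) ^ (-(1 + δ)) ≤ 1 / 2) :
    ∑ k ∈ Finset.Icc 1 n, a k * (k : ℝ) ^ (-(1 + δ) / 2) ≤
      2 * a n * (n : ℝ) ^ (-(1 + δ) / 2) := by
  set s : ℝ := -(1 + δ) / 2 with hs
  set A := ∑ k ∈ Finset.Icc 1 n, a k * (k : ℝ) ^ s with hA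
  have hA0 : 0 ≤ A := Finset.sum_nonneg fun k _ => mul_nonneg (ha k) (by positivity)
  have hsplit : A = ∑ k ∈ Finset.Ico 1 n, a k * (k : ℝ) ^ s + a n * (n : ℝ) ^ s := by
    rw [hA, ← Finset.Ico_insert_right hn, Finset.sum_insert (by simp), add_comm]
  have hterm : ∀ k ∈ Finset.Ico 1 n,
      a k * (k : ℝ) ^ s ≤ ε * c * A * (k : ℝ) ^ (-(1 + δ)) := by
    intro k hk
    obtain ⟨hk1, hkn⟩ := Finset.mem_Ico.mp hk
    have hk0 : (0 : ℝ) < k := by exact_mod_cast hk1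
    have hsum : ∑ m ∈ Finset.Icc 1 n, a m * (c * ((k : ℝ) * m) ^ s) = c * (k : ℝ) ^ s * A := by
      rw [hA, Finset.mul_sum]
      refine Finset.sum_congr rfl fun m _ => ?_
      rw [Real.mul_rpow hk0.le (Nat.cast_nonneg m)]
      ring
    have hpow : (k : ℝ) ^ (-(1 + δ)) = (k : ℝ) ^ s * (k : ℝ) ^ s := by
      rw [← Real.rpow_add hk0, hs, add_halves]
    calc a k * (k : ℝ) ^ s ≤ ε * (c * (k : ℝ) ^ s * A) * (k : ℝ) ^ s := by
          rw [← hsum]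
          exact mul_le_mul_of_nonneg_right (hrec k hk1 hkn) (by positivity)
      _ = ε * c * A * (k : ℝ) ^ (-(1 + δ)) := by rw [hpow]; ring
  have hhead := Finset.sum_le_sum hterm
  rw [← Finset.mul_sum] at hhead
  have hhalf := mul_le_mul_of_nonneg_right hsmall hA0
  linarith
end
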